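/- arXiv:2412.14091 — 6 statements merged into one kernel-verified Lean document; each statement's English description precedes it below -/
import Mathlib

section
/- Let k ≥ 1 and n ≥ k, and let A be a k×n complex matrix satisfying A·Aᵀ = 0 (i.e. the rows of A are isotropic and pairwise orthogonal for the standard symmetric bilinear form (x,y) = Σ_{i=1}^n x_i y_i). Then for all (k−1)-element subsets I, J of {1,…,n}, the maximal minors of A satisfy Σ_{ℓ ∈ {1,…,n}∖(I∪J)} ε(Iℓ) ε(Jℓ) p_{I∪{ℓ}}(A) p_{J∪{ℓ}}(A) = 0. -/
open Matrix

/-- The Plücker coordinate `p_I(A)` of a `k × n` matrix `A`: the determinant of the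
`k × k` submatrix of `A` whose columns are indexed by `I`, taken in increasing order.
(Defined to be `0` when `I` does not have exactly `k` elements.) -/
noncomputable def plucker {R : Type} [CommRing R] {k n : ℕ}
    (A : Matrix (Fin k) (Fin n) R) (I : Finset (Fin n)) : R :=
  if h : I.card = k then
    (Matrix.of fun (i : Fin k) (j : Fin k) => A i (I.orderEmbOfFin h j)).det
  else 0

/-- The sign `ε(Iℓ) = (-1)^{#{i ∈ I : i > ℓ}}`, i.e. the sign of the permutation sorting
the string `Iℓ`. -/
def epsSign {n : ℕ} (I : Finset (Fin n)) (l : Fin n) : ℤ :=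
  (-1) ^ (I.filter fun i => l < i).card

/-- The signed minor of `A` on the columns indexed by `I` obtained by deleting row `i`. -/
noncomputable def signedMinor {R : Type} [CommRing R] {m n : ℕ}
    (A : Matrix (Fin (m + 1)) (Fin n) R) (I : Finset (Fin n)) (hI : I.card = m)
    (i : Fin (m + 1)) : R :=
  (-1) ^ (i : ℕ) * (A.submatrix i.succAbove (I.orderEmbOfFin hI)).det

/-- Laplace expansion along a column whose deletion leaves the columns indexed by `I`. -/
theorem det_submatrix_eq_sum_signedMinor {R : Type} [CommRing R] {m n : ℕ}
    (A : Matrix (Fin (m + 1)) (Fin n) R) (I : Finset (Fin n)) (hI : I.card = m)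
    (e : Fin (m + 1) → Fin n) (p : Fin (m + 1))
    (he : ∀ j, e (p.succAbove j) = I.orderEmbOfFin hI j) :
    (A.submatrix id e).det = (-1) ^ (p : ℕ) * ∑ i, signedMinor A I hI i * A i (e p) := by
  rw [Matrix.det_succ_column _ p, Finset.mul_sum]
  refine Finset.sum_congr rfl fun i _ => ?_
  have hsub : (A.submatrix id e).submatrix i.succAbove p.succAbove =
      A.submatrix i.succAbove (I.orderEmbOfFin hI) := by
    ext a b
    simp [he]
  rw [hsub, signedMinor, pow_add, Matrix.submatrix_apply, id]
  ring

theorem sum_signedMinor_eq_zero {R : Type} [CommRing R] {m n : ℕ}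
    (A : Matrix (Fin (m + 1)) (Fin n) R) (I : Finset (Fin n)) (hI : I.card = m)
    {l : Fin n} (hl : l ∈ I) : ∑ i, signedMinor A I hI i * A i l = 0 := by
  have h := det_submatrix_eq_sum_signedMinor A I hI
    (Fin.cons l (I.orderEmbOfFin hI) : Fin (m + 1) → Fin n) 0 (fun j => by simp)
  have hr : l ∈ Set.range (I.orderEmbOfFin hI) := by simpa using hl
  obtain ⟨j, hj⟩ := hr
  rw [Matrix.det_zero_of_column_eq (i := 0) (j := j.succ) (Fin.succ_ne_zero j).symm
    (fun i => by simp [hj])] at h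
  simpa using h.symm

theorem epsSign_mul_plucker_insert {R : Type} [CommRing R] {m n : ℕ}
    (A : Matrix (Fin (m + 1)) (Fin n) R) (I : Finset (Fin n)) (hI : I.card = m)
    {l : Fin n} (hl : l ∉ I) :
    (epsSign I l : R) * plucker A (insert l I) =
      (-1) ^ m * ∑ i, signedMinor A I hI i * A i l := by
  have hc : (insert l I).card = m + 1 := by rw [Finset.card_insert_of_notMem hl, hI]
  set e := (insert l I).orderEmbOfFin hc with he
  have hr : l ∈ Set.range e := by simp [he]
  obtain ⟨p, hp⟩ := hr
  have hmem : ∀ j, e (p.succAbove j) ∈ I := fun j => by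
    have h1 : e (p.succAbove j) ∈ insert l I := Finset.orderEmbOfFin_mem _ hc _
    refine (Finset.mem_insert.1 h1).resolve_left fun h => ?_
    rw [← hp] at h
    exact Fin.succAbove_ne p j (e.injective h)
  have hsucc := Finset.orderEmbOfFin_unique hI (f := fun j => e (p.succAbove j)) hmem
    (e.strictMono.comp (Fin.strictMono_succAbove p))
  have hcard : (I.filter fun i => l < i).card = m - p := by
    have : (I.filter fun i => l < i) = (Finset.Ioi p).map e.toEmbedding := by
      ext x
      simp only [Finset.mem_filter, Finset.mem_map, Finset.mem_Ioi]
      constructor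
      · rintro ⟨hx, hlx⟩
        have hxr : x ∈ Set.range e := by simp [he, hx]
        obtain ⟨q, rfl⟩ := hxr
        exact ⟨q, e.lt_iff_lt.1 (hp ▸ hlx), rfl⟩
      · rintro ⟨q, hq, rfl⟩
        obtain ⟨j, rfl⟩ := Fin.exists_succAbove_eq hq.ne'
        exact ⟨hmem j, hp ▸ e.lt_iff_lt.2 hq⟩
    rw [this, Finset.card_map, Fin.card_Ioi]
    omega
  have hdet : plucker A (insert l I) = (A.submatrix id e).det := by
    rw [plucker, dif_pos hc]
    rfl
  rw [hdet, det_submatrix_eq_sum_signedMinor A I hI e p (fun j => congrFun hsucc j), hp,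
    epsSign, hcard, ← mul_assoc]
  push_cast
  rw [← pow_add, Nat.sub_add_cancel (Nat.lt_succ_iff.1 p.isLt)]

/-- If `A` is a `k × n` complex matrix with `A * Aᵀ = 0` (rows isotropic
and pairwise orthogonal for the standard symmetric bilinear form), then for all
`(k-1)`-element subsets `I, J` of the column set, the sum over `ℓ ∉ I ∪ J` of
`ε(Iℓ) ε(Jℓ) p_{I∪{ℓ}}(A) p_{J∪{ℓ}}(A)` vanishes. -/
theorem statement0 {k n : ℕ} (hk : 1 ≤ k) (hkn : k ≤ n)
    (A : Matrix (Fin k) (Fin n) ℂ) (hA : A * Aᵀ = 0)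
    (I J : Finset (Fin n)) (hI : I.card = k - 1) (hJ : J.card = k - 1) :
    ∑ l ∈ (I ∪ J)ᶜ, ((epsSign I l : ℂ) * (epsSign J l : ℂ) *
      plucker A (insert l I) * plucker A (insert l J)) = 0 := by
  obtain ⟨m, rfl⟩ := Nat.exists_eq_add_of_le' hk
  rw [Nat.add_sub_cancel] at hI hJ
  set f : Fin n → ℂ := fun l => ∑ i, signedMinor A I hI i * A i l with hf
  set g : Fin n → ℂ := fun l => ∑ i, signedMinor A J hJ i * A i l with hg
  have hterm : ∀ l ∈ (I ∪ J)ᶜ, (epsSign I l : ℂ) * (epsSign J l : ℂ) *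
      plucker A (insert l I) * plucker A (insert l J) = f l * g l := fun l hl => by
    simp only [Finset.mem_compl, Finset.mem_union, not_or] at hl
    have hs : ((-1 : ℂ) ^ m) * (-1) ^ m = 1 := by rw [← mul_pow]; simp
    calc _ = ((epsSign I l : ℂ) * plucker A (insert l I)) *
          ((epsSign J l : ℂ) * plucker A (insert l J)) := by ring
      _ = ((-1) ^ m * (-1) ^ m) * (f l * g l) := by
        rw [epsSign_mul_plucker_insert A I hI hl.1, epsSign_mul_plucker_insert A J hJ hl.2]
        ring
      _ = f l * g l := by rw [hs, one_mul]
  rw [Finset.sum_congr rfl hterm, Finset.sum_subset (Finset.subset_univ _) fun l _ hl => ?_]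
  · have hfv : f = signedMinor A I hI ᵥ* A := rfl
    have hgv : g = signedMinor A J hJ ᵥ* A := rfl
    change f ⬝ᵥ g = 0
    rw [hfv, hgv, ← Matrix.mulVec_transpose A (signedMinor A J hJ), Matrix.dotProduct_mulVec,
      Matrix.vecMul_vecMul, hA, Matrix.vecMul_zero, zero_dotProduct]
  · simp only [Finset.mem_compl, not_not, Finset.mem_union] at hl
    rcases hl with hl | hl
    · rw [show f l = 0 from sum_signedMinor_eq_zero A I hI hl, zero_mul]
    · rw [show g l = 0 from sum_signedMinor_eq_zero A J hJ hl, mul_zero]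
end

section
/- Let k ≥ 1 and n ≥ 2k. The number of pairs (S₁, S₂) of (k−1)-element subsets of {1,…,n} with S₁ ≤ S₂ equals the number of pairs (T₁, T₂) of k-element subsets of {1,…,n} such that T₁ ≤ T₂ and the complement T₁ᶜ = {1,…,n}∖T₁ does NOT satisfy T₁ᶜ ≤ T₂ (where for the (n−k)-element set T₁ᶜ = {c₁<…<c_{n−k}} and T₂ = {t₁<…<t_k}, T₁ᶜ ≤ T₂ means c_r ≤ t_r for r = 1,…,k). -/
/-- The componentwise (Gale / Young-lattice) comparison of two finite sets of column
indices, listed in increasing order: the `i`-th smallest element of `S` is at most the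
`i`-th smallest element of `T`, for every index `i` valid for both sets.  For sets of
equal cardinality this is exactly the Gale order `S ≤ T`; for `C` of cardinality `n - k`
and `T` of cardinality `k` with `2k ≤ n` it compares the first `k` elements of `C` with
those of `T`. -/
def galeLE {n : ℕ} (S T : Finset (Fin n)) : Prop :=
  ∀ (i : ℕ) (hS : i < S.card) (hT : i < T.card),
    S.orderEmbOfFin rfl ⟨i, hS⟩ ≤ T.orderEmbOfFin rfl ⟨i, hT⟩

/-- The number of elements of `S` among the first `m` elements of `Fin n`. -/
def prefixCard {n : ℕ} (S : Finset (Fin n)) (m : ℕ) : ℕ :=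
  (S.filter fun i => i.val < m).card

theorem prefixCard_zero {n : ℕ} (S : Finset (Fin n)) : prefixCard S 0 = 0 := by
  simp [prefixCard]

theorem prefixCard_self {n : ℕ} (S : Finset (Fin n)) : prefixCard S n = S.card := by
  simp [prefixCard]

theorem prefixCard_succ {n : ℕ} (S : Finset (Fin n)) (i : Fin n) :
    prefixCard S (i.val + 1) = prefixCard S i.val + if i ∈ S then 1 else 0 := by
  unfold prefixCard
  split_ifs with hi
  · have h : (S.filter fun j => j.val < i.val + 1) =
        insert i (S.filter fun j => j.val < i.val) := by
      ext j
      simp only [Finset.mem_filter, Finset.mem_insert, Fin.ext_iff]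
      constructor
      · rintro ⟨hj, hlt⟩
        by_cases h : j.val = i.val
        · exact Or.inl h
        · exact Or.inr ⟨hj, by omega⟩
      · rintro (h | ⟨hj, hlt⟩)
        · exact ⟨Fin.ext h ▸ hi, by omega⟩
        · exact ⟨hj, by omega⟩
    rw [h, Finset.card_insert_of_notMem (by simp)]
  · rw [add_zero]
    congr 1
    ext j
    simp only [Finset.mem_filter]
    constructor
    · rintro ⟨hj, hlt⟩
      have : j.val ≠ i.val := fun h => hi (Fin.ext h ▸ hj)
      exact ⟨hj, by omega⟩
    · rintro ⟨hj, hlt⟩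
      exact ⟨hj, by omega⟩

theorem orderEmbOfFin_lt_iff {n : ℕ} (S : Finset (Fin n)) (m i : ℕ) (hi : i < S.card) :
    (S.orderEmbOfFin rfl ⟨i, hi⟩).val < m ↔ i < prefixCard S m := by
  constructor
  · intro h
    have hsub : (Finset.Iic (⟨i, hi⟩ : Fin S.card)).map (S.orderEmbOfFin rfl).toEmbedding ⊆
        S.filter fun j => j.val < m := by
      intro j hj
      obtain ⟨l, hl, rfl⟩ := Finset.mem_map.1 hj
      refine Finset.mem_filter.2 ⟨Finset.orderEmbOfFin_mem _ _ _, lt_of_le_of_lt ?_ h⟩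
      exact (S.orderEmbOfFin rfl).monotone (Finset.mem_Iic.1 hl)
    have := Finset.card_le_card hsub
    rw [Finset.card_map, Fin.card_Iic] at this
    exact this
  · intro h
    by_contra hm
    have hsub : (S.filter fun j => j.val < m) ⊆
        (Finset.Iio (⟨i, hi⟩ : Fin S.card)).map (S.orderEmbOfFin rfl).toEmbedding := by
      intro j hj
      obtain ⟨hj, hlt⟩ := Finset.mem_filter.1 hj
      have hr : j ∈ Set.range (S.orderEmbOfFin rfl) := by
        rw [Finset.range_orderEmbOfFin]; exact hj
      obtain ⟨l, rfl⟩ := hr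
      refine Finset.mem_map.2 ⟨l, Finset.mem_Iio.2 ?_, rfl⟩
      by_contra hl
      have : (S.orderEmbOfFin rfl ⟨i, hi⟩).val ≤ (S.orderEmbOfFin rfl l).val :=
        (S.orderEmbOfFin rfl).monotone (not_lt.1 hl)
      omega
    have := Finset.card_le_card hsub
    rw [Finset.card_map, Fin.card_Iio] at this
    exact absurd h (not_lt.2 this)

theorem galeLE_iff_prefixCard_le {n : ℕ} {S T : Finset (Fin n)} (hc : T.card ≤ S.card) :
    galeLE S T ↔ ∀ m ≤ n, prefixCard T m ≤ prefixCard S m := by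
  constructor
  · intro h m _
    by_contra hlt
    have hT : prefixCard S m < T.card :=
      lt_of_lt_of_le (not_le.1 hlt) (Finset.card_le_card (Finset.filter_subset _ _))
    have hle := h _ (hT.trans_le hc) hT
    have h1 := (orderEmbOfFin_lt_iff T m _ hT).2 (not_le.1 hlt)
    exact lt_irrefl _ ((orderEmbOfFin_lt_iff S m _ (hT.trans_le hc)).1 (lt_of_le_of_lt hle h1))
  · intro h i hS hT
    have h1 := (orderEmbOfFin_lt_iff T ((T.orderEmbOfFin rfl ⟨i, hT⟩).val + 1) i hT).1
      (Nat.lt_succ_self _)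
    have h2 := (orderEmbOfFin_lt_iff S _ i hS).2 (h1.trans_le (h _ (Fin.is_lt _)))
    exact Nat.lt_succ_iff.1 h2

theorem prefixCard_compl {n : ℕ} (S : Finset (Fin n)) (m : ℕ) (hm : m ≤ n) :
    prefixCard Sᶜ m + prefixCard S m = m := by
  induction m with
  | zero => simp [prefixCard_zero]
  | succ m ih =>
    have h1 := prefixCard_succ S ⟨m, hm⟩
    have h2 := prefixCard_succ Sᶜ ⟨m, hm⟩
    have := ih (by omega)
    simp only [Finset.mem_compl] at h1 h2
    split_ifs at h1 h2 <;> first | contradiction | omega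

/-- The set that agrees with the complement of `T` on the first `m` elements and with `S`
afterwards. -/
def complPrefix {n : ℕ} (m : ℕ) (S T : Finset (Fin n)) : Finset (Fin n) :=
  Finset.univ.filter fun i => if i.val < m then i ∉ T else i ∈ S

theorem complPrefix_complPrefix {n : ℕ} (m : ℕ) (S T : Finset (Fin n)) :
    complPrefix m (complPrefix m S T) (complPrefix m T S) = S := by
  ext i
  by_cases h : i.val < m <;> simp [complPrefix, h]

theorem prefixCard_complPrefix_of_le {n : ℕ} (S T : Finset (Fin n)) {m l : ℕ} (hl : l ≤ m)
    (hn : l ≤ n) : prefixCard (complPrefix m S T) l + prefixCard T l = l := by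
  induction l with
  | zero => simp [prefixCard_zero]
  | succ l ih =>
    have h1 := prefixCard_succ T ⟨l, hn⟩
    have h2 := prefixCard_succ (complPrefix m S T) ⟨l, hn⟩
    have := ih (by omega) (by omega)
    have hlm : l < m := hl
    simp only [complPrefix, Finset.mem_filter, Finset.mem_univ, true_and, hlm, if_true] at h1 h2 this ⊢
    split_ifs at h1 h2 <;> first | contradiction | omega

theorem prefixCard_complPrefix_of_ge {n : ℕ} (S T : Finset (Fin n)) {m l : ℕ} (hl : m ≤ l)
    (hn : l ≤ n) :
    prefixCard (complPrefix m S T) l + prefixCard T m + prefixCard S m = m + prefixCard S l := by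
  induction l, hl using Nat.le_induction with
  | base => rw [prefixCard_complPrefix_of_le S T le_rfl hn]
  | succ l hl ih =>
    have h1 := prefixCard_succ S ⟨l, hn⟩
    have h2 := prefixCard_succ (complPrefix m S T) ⟨l, hn⟩
    have := ih (by omega)
    have hlm : ¬ l < m := by omega
    simp only [complPrefix, Finset.mem_filter, Finset.mem_univ, true_and, hlm, if_false] at h1 h2 this ⊢
    split_ifs at h1 h2 <;> first | contradiction | omega

theorem prefixCard_le_prefixCard_succ {n : ℕ} (S : Finset (Fin n)) {m : ℕ} (hm : m < n) :
    prefixCard S m ≤ prefixCard S (m + 1) ∧ prefixCard S (m + 1) ≤ prefixCard S m + 1 := by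
  have h := prefixCard_succ S ⟨m, hm⟩
  split_ifs at h <;> simp only at h <;> omega

/-- Complementing prefixes preserves the order of the prefix counts. -/
theorem prefixCard_complPrefix_le {n : ℕ} {S T : Finset (Fin n)}
    (h : ∀ m ≤ n, prefixCard T m ≤ prefixCard S m) (m : ℕ) :
    ∀ l ≤ n, prefixCard (complPrefix m T S) l ≤ prefixCard (complPrefix m S T) l := by
  intro l hl
  have h0 := h l hl
  rcases le_total l m with hlm | hlm
  · have h1 := prefixCard_complPrefix_of_le S T hlm hl
    have h2 := prefixCard_complPrefix_of_le T S hlm hl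
    omega
  · have h1 := prefixCard_complPrefix_of_ge S T hlm hl
    have h2 := prefixCard_complPrefix_of_ge T S hlm hl
    omega

theorem exists_prefixCard_add_eq_succ {n : ℕ} {S T : Finset (Fin n)}
    (h : ∃ m ≤ n, m < prefixCard S m + prefixCard T m) :
    ∃ m ≤ n, prefixCard S m + prefixCard T m = m + 1 := by
  classical
  obtain ⟨hn, hlt⟩ := Nat.find_spec h
  have hmin := fun l (hl : l < Nat.find h) => Nat.find_min h hl
  generalize Nat.find h = m at hn hlt hmin
  refine ⟨m, hn, ?_⟩
  cases m with
  | zero => simp [prefixCard_zero] at hlt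
  | succ m =>
    have h1 := prefixCard_le_prefixCard_succ S (m := m) (by omega)
    have h2 := prefixCard_le_prefixCard_succ T (m := m) (by omega)
    have h3 : ¬ m < prefixCard S m + prefixCard T m := fun h => hmin m (by omega) ⟨by omega, h⟩
    omega

theorem exists_prefixCard_add_succ_eq {n : ℕ} {S T : Finset (Fin n)}
    (h : ∃ m ≤ n, prefixCard S m + prefixCard T m < m) :
    ∃ m ≤ n, prefixCard S m + prefixCard T m + 1 = m := by
  classical
  obtain ⟨hn, hlt⟩ := Nat.find_spec h
  have hmin := fun l (hl : l < Nat.find h) => Nat.find_min h hl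
  generalize Nat.find h = m at hn hlt hmin
  refine ⟨m, hn, ?_⟩
  cases m with
  | zero => simp at hlt
  | succ m =>
    have h1 := prefixCard_le_prefixCard_succ S (m := m) (by omega)
    have h2 := prefixCard_le_prefixCard_succ T (m := m) (by omega)
    have h3 : ¬ prefixCard S m + prefixCard T m < m := fun h => hmin m (by omega) ⟨by omega, h⟩
    omega

theorem not_galeLE_compl_iff {n : ℕ} {S T : Finset (Fin n)} (hc : S.card + T.card ≤ n) :
    ¬ galeLE Sᶜ T ↔ ∃ m ≤ n, prefixCard S m + prefixCard T m = m + 1 := by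
  have hcard : T.card ≤ Sᶜ.card := by
    rw [Finset.card_compl, Fintype.card_fin]
    omega
  rw [galeLE_iff_prefixCard_le hcard]
  constructor
  · intro h
    push Not at h
    obtain ⟨m, hm, hlt⟩ := h
    have := prefixCard_compl S m hm
    exact exists_prefixCard_add_eq_succ ⟨m, hm, by omega⟩
  · rintro ⟨m, hm, heq⟩ h
    have := prefixCard_compl S m hm
    have := h m hm
    omega

/-- The first `m` at which `S` and `T` have `m + 1` elements in total among the first `m`. -/
noncomputable def firstExcess {n : ℕ} (S T : Finset (Fin n)) : ℕ :=
  sInf {m | m ≤ n ∧ prefixCard S m + prefixCard T m = m + 1}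

/-- The first `m` at which `S` and `T` have `m - 1` elements in total among the first `m`. -/
noncomputable def firstDeficit {n : ℕ} (S T : Finset (Fin n)) : ℕ :=
  sInf {m | m ≤ n ∧ prefixCard S m + prefixCard T m + 1 = m}

theorem firstDeficit_complPrefix {n : ℕ} {S T : Finset (Fin n)} {m : ℕ} (hm : m ≤ n)
    (heq : prefixCard S m + prefixCard T m = m + 1) (hmin : firstExcess S T = m) :
    firstDeficit (complPrefix m S T) (complPrefix m T S) = m := by
  have h1 := prefixCard_complPrefix_of_le S T le_rfl hm
  have h2 := prefixCard_complPrefix_of_le T S le_rfl hm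
  have hmem : m ∈ {l | l ≤ n ∧ prefixCard (complPrefix m S T) l +
      prefixCard (complPrefix m T S) l + 1 = l} := ⟨hm, by omega⟩
  refine le_antisymm (Nat.sInf_le hmem) ?_
  refine le_csInf ⟨m, hmem⟩ ?_
  rintro l ⟨hl, hle⟩
  by_contra hlt
  have h3 := prefixCard_complPrefix_of_le S T (not_le.1 hlt).le hl
  have h4 := prefixCard_complPrefix_of_le T S (not_le.1 hlt).le hl
  have : firstExcess S T ≤ l := Nat.sInf_le ⟨hl, by omega⟩
  omega

theorem firstExcess_complPrefix {n : ℕ} {S T : Finset (Fin n)} {m : ℕ} (hm : m ≤ n)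
    (heq : prefixCard S m + prefixCard T m + 1 = m) (hmin : firstDeficit S T = m) :
    firstExcess (complPrefix m S T) (complPrefix m T S) = m := by
  have h1 := prefixCard_complPrefix_of_le S T le_rfl hm
  have h2 := prefixCard_complPrefix_of_le T S le_rfl hm
  have hmem : m ∈ {l | l ≤ n ∧ prefixCard (complPrefix m S T) l +
      prefixCard (complPrefix m T S) l = l + 1} := ⟨hm, by omega⟩
  refine le_antisymm (Nat.sInf_le hmem) ?_
  refine le_csInf ⟨m, hmem⟩ ?_
  rintro l ⟨hl, hle⟩
  by_contra hlt
  have h3 := prefixCard_complPrefix_of_le S T (not_le.1 hlt).le hl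
  have h4 := prefixCard_complPrefix_of_le T S (not_le.1 hlt).le hl
  have : firstDeficit S T ≤ l := Nat.sInf_le ⟨hl, by omega⟩
  omega

theorem firstExcess_spec {n : ℕ} {S T : Finset (Fin n)}
    (h : ∃ m ≤ n, prefixCard S m + prefixCard T m = m + 1) :
    firstExcess S T ≤ n ∧ prefixCard S (firstExcess S T) + prefixCard T (firstExcess S T) =
      firstExcess S T + 1 :=
  Nat.sInf_mem (s := {m | m ≤ n ∧ prefixCard S m + prefixCard T m = m + 1}) h

theorem firstDeficit_spec {n : ℕ} {S T : Finset (Fin n)} (h : S.card + T.card < n) :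
    firstDeficit S T ≤ n ∧ prefixCard S (firstDeficit S T) + prefixCard T (firstDeficit S T) + 1 =
      firstDeficit S T :=
  Nat.sInf_mem (s := {m | m ≤ n ∧ prefixCard S m + prefixCard T m + 1 = m})
    (exists_prefixCard_add_succ_eq ⟨n, le_rfl, by simpa only [prefixCard_self] using h⟩)

theorem card_complPrefix {n : ℕ} (S T : Finset (Fin n)) {m : ℕ} (hm : m ≤ n) :
    (complPrefix m S T).card + prefixCard T m + prefixCard S m = m + S.card := by
  simpa only [prefixCard_self] using prefixCard_complPrefix_of_ge S T hm le_rfl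

/-- For `k ≥ 1` and `n ≥ 2k`, the number of pairs `(S₁, S₂)` of
`(k-1)`-element subsets of `{1, …, n}` with `S₁ ≤ S₂` equals the number of pairs
`(T₁, T₂)` of `k`-element subsets with `T₁ ≤ T₂` such that the complement `T₁ᶜ` does
not satisfy `T₁ᶜ ≤ T₂` (comparing the first `k` elements of `T₁ᶜ` with those of
`T₂`). -/
theorem statement5 {k n : ℕ} (hk : 1 ≤ k) (hn : 2 * k ≤ n) :
    Nat.card {p : Finset (Fin n) × Finset (Fin n) //
        p.1.card = k - 1 ∧ p.2.card = k - 1 ∧ galeLE p.1 p.2} =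
    Nat.card {p : Finset (Fin n) × Finset (Fin n) //
        p.1.card = k ∧ p.2.card = k ∧ galeLE p.1 p.2 ∧ ¬ galeLE p.1ᶜ p.2} := by
  refine Nat.card_congr
    { toFun := fun p => ⟨(complPrefix (firstDeficit p.1.1 p.1.2) p.1.1 p.1.2,
        complPrefix (firstDeficit p.1.1 p.1.2) p.1.2 p.1.1), ?_⟩
      invFun := fun p => ⟨(complPrefix (firstExcess p.1.1 p.1.2) p.1.1 p.1.2,
        complPrefix (firstExcess p.1.1 p.1.2) p.1.2 p.1.1), ?_⟩
      left_inv := ?_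
      right_inv := ?_ }
  · obtain ⟨⟨S, T⟩, hS, hT, hle⟩ := p
    dsimp only at hS hT hle ⊢
    obtain ⟨hm, heq⟩ := firstDeficit_spec (S := S) (T := T) (by omega)
    rw [galeLE_iff_prefixCard_le (by omega)] at hle
    have hle' := prefixCard_complPrefix_le hle (firstDeficit S T)
    have h1 := card_complPrefix S T hm
    have h2 := card_complPrefix T S hm
    have h3 := prefixCard_complPrefix_of_le S T le_rfl hm
    have h4 := prefixCard_complPrefix_of_le T S le_rfl hm
    refine ⟨by omega, by omega, (galeLE_iff_prefixCard_le (by omega)).2 hle', ?_⟩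
    exact (not_galeLE_compl_iff (by omega)).2 ⟨_, hm, by omega⟩
  · obtain ⟨⟨S, T⟩, hS, hT, hle, hex⟩ := p
    dsimp only at hS hT hle hex ⊢
    obtain ⟨hm, heq⟩ := firstExcess_spec ((not_galeLE_compl_iff (S := S) (T := T) (by omega)).1 hex)
    rw [galeLE_iff_prefixCard_le (by omega)] at hle
    have hle' := prefixCard_complPrefix_le hle (firstExcess S T)
    have h1 := card_complPrefix S T hm
    have h2 := card_complPrefix T S hm
    exact ⟨by omega, by omega, (galeLE_iff_prefixCard_le (by omega)).2 hle'⟩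
  · rintro ⟨⟨S, T⟩, hS, hT, hle⟩
    dsimp only at hS hT hle ⊢
    obtain ⟨hm, heq⟩ := firstDeficit_spec (S := S) (T := T) (by omega)
    simp only [firstExcess_complPrefix hm heq rfl, complPrefix_complPrefix]
  · rintro ⟨⟨S, T⟩, hS, hT, hle, hex⟩
    dsimp only at hS hT hle hex ⊢
    obtain ⟨hm, heq⟩ := firstExcess_spec ((not_galeLE_compl_iff (S := S) (T := T) (by omega)).1 hex)
    simp only [firstDeficit_complPrefix hm heq rfl, complPrefix_complPrefix]
end

section
/- Let k ≥ 2 and n ≥ k−1. The number of pairs (S₁, S₂) of (k−1)-element subsets of {1,…,n} with S₁ ≤ S₂ (equivalently, the number of semistandard Young tableaux of shape (k−1, k−1) with entries in {1,…,n}) equals (1/(k−1))·C(n+1, k)·C(n, k−2); that is, (k−1) times this number of pairs equals C(n+1,k)·C(n,k−2). -/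
open Finset in
/-- The `i`-th smallest element of `S` is at most `j` exactly when more than `i` elements of `S`
are at most `j`. -/
theorem orderEmbOfFin_le_iff_lt_card_filter {α : Type*} [LinearOrder α] (S : Finset α) (j : α)
    (i : Fin S.card) :
    S.orderEmbOfFin rfl i ≤ j ↔ (i : ℕ) < (S.filter (· ≤ j)).card := by
  have hmap : S.filter (· ≤ j) =
      (univ.filter fun x => S.orderEmbOfFin rfl x ≤ j).map (S.orderEmbOfFin rfl).toEmbedding := by
    conv_lhs => rw [← S.map_orderEmbOfFin_univ rfl]
    rw [filter_map]
    rfl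
  rw [hmap, card_map]
  constructor
  · intro h
    have hsub : Iic i ⊆ univ.filter fun x => S.orderEmbOfFin rfl x ≤ j := by
      intro x hx
      simp only [mem_filter, mem_univ, true_and]
      exact ((S.orderEmbOfFin rfl).monotone (mem_Iic.1 hx)).trans h
    have hcard := card_le_card hsub
    rw [Fin.card_Iic] at hcard
    omega
  · intro h
    by_contra hj
    have hsub : (univ.filter fun x => S.orderEmbOfFin rfl x ≤ j) ⊆ Iio i := by
      intro x hx
      simp only [mem_filter, mem_univ, true_and] at hx
      exact mem_Iio.2 ((S.orderEmbOfFin rfl).lt_iff_lt.1 (hx.trans_lt (not_le.1 hj)))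
    have hcard := card_le_card hsub
    rw [Fin.card_Iio] at hcard
    omega

/-- For sets of equal cardinality the Gale order is the ballot condition: every initial segment
contains at least as many elements of `S` as of `T`. -/
theorem galeLE_iff_card_filter_le {n : ℕ} {S T : Finset (Fin n)} (h : S.card = T.card) :
    galeLE S T ↔ ∀ j : Fin n, (T.filter (· ≤ j)).card ≤ (S.filter (· ≤ j)).card := by
  constructor
  · intro hST j
    by_contra! hlt
    have hT := hlt.trans_le (Finset.card_filter_le T (· ≤ j))
    have hle := hST _ (h ▸ hT) hT
    have := (orderEmbOfFin_le_iff_lt_card_filter T j ⟨_, hT⟩).2 hlt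
    exact lt_irrefl _ ((orderEmbOfFin_le_iff_lt_card_filter S j ⟨_, h ▸ hT⟩).1 (hle.trans this))
  · intro hST i hS hT
    rw [orderEmbOfFin_le_iff_lt_card_filter]
    exact ((orderEmbOfFin_le_iff_lt_card_filter T _ ⟨i, hT⟩).1 le_rfl).trans_le (hST _)

/-- Every initial segment `{0, …, j - 1}` with `j ≤ n` contains at least as many elements of `S`
as of `T`. -/
def Ballot (n : ℕ) (S T : Finset ℕ) : Prop :=
  ∀ j ≤ n, (T.filter (· < j)).card ≤ (S.filter (· < j)).card

theorem filter_lt_insert_of_le {n j : ℕ} (h : j ≤ n) (S : Finset ℕ) :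
    (insert n S).filter (· < j) = S.filter (· < j) := by
  rw [Finset.filter_insert, if_neg (by omega)]

theorem ballot_insert_left {n : ℕ} {S T : Finset ℕ} :
    Ballot n (insert n S) T ↔ Ballot n S T :=
  forall₂_congr fun j hj => by rw [filter_lt_insert_of_le hj]

theorem ballot_insert_right {n : ℕ} {S T : Finset ℕ} :
    Ballot n S (insert n T) ↔ Ballot n S T :=
  forall₂_congr fun j hj => by rw [filter_lt_insert_of_le hj]

theorem filter_lt_eq_self_of_subset_range {n : ℕ} {S : Finset ℕ} (h : S ⊆ Finset.range n) :
    S.filter (· < n) = S :=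
  Finset.filter_true_of_mem fun _ hx => Finset.mem_range.1 (h hx)

theorem ballot_succ {n : ℕ} {S T : Finset ℕ} (hS : S ⊆ Finset.range (n + 1))
    (hT : T ⊆ Finset.range (n + 1)) (hcard : T.card ≤ S.card) :
    Ballot (n + 1) S T ↔ Ballot n S T := by
  refine ⟨fun h j hj => h j (by omega), fun h j hj => ?_⟩
  rcases Nat.le_succ_iff.1 hj with hj | rfl
  · exact h j hj
  · rwa [filter_lt_eq_self_of_subset_range hS, filter_lt_eq_self_of_subset_range hT]

open Classical in
/-- The number of ballot pairs `(S, T)` of subsets of `{0, …, n - 1}` of sizes `a` and `b`. -/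
noncomputable def ballotCount (n a b : ℕ) : ℕ :=
  ∑ S ∈ Finset.powersetCard a (Finset.range n), ∑ T ∈ Finset.powersetCard b (Finset.range n),
    if Ballot n S T then 1 else 0

theorem sum_powersetCard_range_succ (n a : ℕ) (f : Finset ℕ → ℕ) :
    ∑ S ∈ Finset.powersetCard (a + 1) (Finset.range (n + 1)), f S =
      ∑ S ∈ Finset.powersetCard (a + 1) (Finset.range n), f S +
        ∑ S ∈ Finset.powersetCard a (Finset.range n), f (insert n S) := by
  have hnot : ∀ {c : ℕ} {S : Finset ℕ}, S ∈ Finset.powersetCard c (Finset.range n) → n ∉ S :=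
    fun hS hn => by simpa using (Finset.mem_powersetCard.1 hS).1 hn
  rw [Finset.range_add_one, Finset.powersetCard_succ_insert Finset.notMem_range_self,
    Finset.sum_union, Finset.sum_image]
  · intro S hS T hT h
    rw [← Finset.erase_insert (hnot hS), h, Finset.erase_insert (hnot hT)]
  · rw [Finset.disjoint_right]
    intro S hS hS'
    obtain ⟨T, -, rfl⟩ := Finset.mem_image.1 hS
    exact hnot hS' (Finset.mem_insert_self _ _)

theorem ballotCount_zero_right (n a : ℕ) : ballotCount n a 0 = n.choose a := by
  simp [ballotCount, Ballot]

theorem ballotCount_eq_zero {n a b : ℕ} (h : a < b) : ballotCount n a b = 0 := by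
  refine Finset.sum_eq_zero fun S hS => Finset.sum_eq_zero fun T hT => if_neg fun hST => ?_
  rw [Finset.mem_powersetCard] at hS hT
  have := hST n le_rfl
  rw [filter_lt_eq_self_of_subset_range hS.1, filter_lt_eq_self_of_subset_range hT.1] at this
  omega

theorem ballotCount_succ {n a b : ℕ} (h : b ≤ a) :
    ballotCount (n + 1) (a + 1) (b + 1) =
      ballotCount n (a + 1) (b + 1) + ballotCount n (a + 1) b +
        (ballotCount n a (b + 1) + ballotCount n a b) := by
  classical
  have hdrop : ballotCount (n + 1) (a + 1) (b + 1) =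
      ∑ S ∈ Finset.powersetCard (a + 1) (Finset.range (n + 1)),
        ∑ T ∈ Finset.powersetCard (b + 1) (Finset.range (n + 1)),
          if Ballot n S T then 1 else 0 := by
    refine Finset.sum_congr rfl fun S hS => Finset.sum_congr rfl fun T hT => ?_
    rw [Finset.mem_powersetCard] at hS hT
    exact if_congr (ballot_succ hS.1 hT.1 (by omega)) rfl rfl
  rw [hdrop]
  simp only [sum_powersetCard_range_succ, ballot_insert_left, ballot_insert_right,
    Finset.sum_add_distrib, ballotCount]
  ring

/-- The reflection formula for ballot pairs. -/
theorem ballotCount_add_choose_mul_choose (n : ℕ) {a b : ℕ} (h : b ≤ a) :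
    ballotCount n a (b + 1) + n.choose (a + 1) * n.choose b = n.choose a * n.choose (b + 1) := by
  induction n generalizing a b with
  | zero => simp [ballotCount]
  | succ n ih =>
    rcases h.eq_or_lt with rfl | hlt
    · rw [ballotCount_eq_zero (Nat.lt_succ_self _), zero_add, mul_comm]
    obtain ⟨a, rfl⟩ : ∃ c, a = c + 1 := ⟨a - 1, by omega⟩
    rw [ballotCount_succ (by omega)]
    have h₁ := ih h
    have h₂ := ih (Nat.lt_succ_iff.1 hlt)
    cases b with
    | zero =>
      simp only [ballotCount_zero_right, Nat.choose_succ_succ', Nat.choose_zero_right] at *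
      linarith
    | succ b =>
      have h₃ := ih (a := a + 1) (b := b) (by omega)
      have h₄ := ih (a := a) (b := b) (by omega)
      simp only [Nat.choose_succ_succ'] at *
      linarith

/-- The Narayana form of the number of ballot pairs of subsets of equal size. -/
theorem succ_mul_ballotCount_self (n m : ℕ) :
    (m + 1) * ballotCount n (m + 1) (m + 1) = (n + 1).choose (m + 2) * n.choose m := by
  have h := ballotCount_add_choose_mul_choose n (Nat.le_succ m)
  rcases lt_or_ge n (m + 1) with hn | hn
  · rw [Nat.choose_eq_zero_of_lt hn] at h
    rw [Nat.choose_eq_zero_of_lt (show n + 1 < m + 2 by omega)]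
    simp_all
  obtain ⟨d, rfl⟩ := Nat.exists_eq_add_of_le hn
  have h₁ := Nat.choose_succ_right_eq (m + 1 + d) m
  have h₂ := Nat.choose_succ_right_eq (m + 1 + d) (m + 1)
  rw [show m + 1 + d - m = d + 1 by omega] at h₁
  rw [show m + 1 + d - (m + 1) = d by omega] at h₂
  rw [Nat.choose_succ_succ']
  simp only [Nat.succ_eq_add_one, add_assoc, Nat.reduceAdd] at *
  generalize (m + (1 + d)).choose m = x at *
  generalize (m + (1 + d)).choose (m + 1) = y at *
  generalize (m + (1 + d)).choose (m + 2) = z at *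
  zify at *
  linear_combination (m + 1 : ℤ) * h + y * h₁ - x * h₂

theorem galeLE_iff_ballot_map {n : ℕ} {S T : Finset (Fin n)} (h : S.card = T.card) :
    galeLE S T ↔ Ballot n (S.map Fin.valEmbedding) (T.map Fin.valEmbedding) := by
  have hcard : ∀ (U : Finset (Fin n)) (j : Fin n),
      ((U.map Fin.valEmbedding).filter (· < (j : ℕ) + 1)).card = (U.filter (· ≤ j)).card := by
    intro U j
    rw [Finset.filter_map, Finset.card_map]
    congr 1
    ext x
    simp
  rw [galeLE_iff_card_filter_le h]
  constructor
  · intro hST j hj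
    cases j with
    | zero => simp
    | succ j => simpa only [hcard _ ⟨j, hj⟩] using hST ⟨j, hj⟩
  · intro hST j
    simpa only [hcard] using hST (j + 1) j.2

theorem card_galeLE_pairs (n m : ℕ) :
    Nat.card {p : Finset (Fin n) × Finset (Fin n) //
      p.1.card = m ∧ p.2.card = m ∧ galeLE p.1 p.2} = ballotCount n m m := by
  classical
  have hrange : Finset.powersetCard m (Finset.range n) =
      (Finset.powersetCard m (Finset.univ : Finset (Fin n))).map
        (Finset.mapEmbedding Fin.valEmbedding).toEmbedding := by
    rw [← Finset.powersetCard_map, Fin.map_valEmbedding_univ, Nat.Iio_eq_range]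
  have hfilter : (Finset.univ.filter fun p : Finset (Fin n) × Finset (Fin n) =>
      p.1.card = m ∧ p.2.card = m ∧ galeLE p.1 p.2) =
      (Finset.powersetCard m Finset.univ ×ˢ Finset.powersetCard m Finset.univ).filter
        fun p => Ballot n (p.1.map Fin.valEmbedding) (p.2.map Fin.valEmbedding) := by
    ext ⟨S, T⟩
    simp only [Finset.mem_filter, Finset.mem_univ, true_and, Finset.mem_product,
      Finset.mem_powersetCard, Finset.subset_univ, and_assoc]
    exact and_congr_right fun hS => and_congr_right fun hT =>
      galeLE_iff_ballot_map (hS.trans hT.symm)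
  rw [Nat.card_eq_fintype_card, Fintype.card_subtype, hfilter, Finset.card_filter,
    Finset.sum_product, ballotCount, hrange]
  simp only [Finset.sum_map]
  rfl

/-- For `k ≥ 2` and `n ≥ k - 1`, the number of pairs `(S₁, S₂)` of
`(k-1)`-element subsets of `{1, …, n}` with `S₁ ≤ S₂` in the Gale order (equivalently,
the number of semistandard Young tableaux of shape `(k-1, k-1)` with entries in
`{1, …, n}`) equals `C(n+1, k) · C(n, k-2) / (k-1)`. -/
theorem statement6 {k n : ℕ} (hk : 2 ≤ k) (hn : k - 1 ≤ n) :
    (k - 1) * Nat.card {p : Finset (Fin n) × Finset (Fin n) //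
        p.1.card = k - 1 ∧ p.2.card = k - 1 ∧ galeLE p.1 p.2} =
    Nat.choose (n + 1) k * Nat.choose n (k - 2) := by
  obtain ⟨m, rfl⟩ := Nat.exists_eq_add_of_le' hk
  rw [card_galeLE_pairs]
  exact succ_mul_ballotCount_self n m
end

section
/- Let k ≥ 1, let S be a subset of {1,…,2k}, and let Ω_S be the 2k×2k diagonal matrix with (Ω_S)_{ii} = −1 if i ∈ S and (Ω_S)_{ii} = +1 otherwise. Let A be a complex k×2k matrix of rank k with A·Ω_S·Aᵀ = 0. Then for every k-element subset I of {1,…,2k}, the maximal minors of A satisfy p_I(A)² = (−1)^{k+|S|} · p_{Iᶜ}(A)², where Iᶜ = {1,…,2k}∖I. In particular the ratio of any two complementary Plücker coordinates (when defined) is ±1 if k+|S| is even and ±√(−1) if k+|S| is odd. -/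
open Matrix

theorem sum_orderEmbOfFin {n k : ℕ} {M : Type*} [AddCommMonoid M] (I : Finset (Fin n))
    (h : I.card = k) (f : Fin n → M) :
    ∑ j : Fin k, f (I.orderEmbOfFin h j) = ∑ l ∈ I, f l := by
  conv_rhs => rw [← Finset.map_orderEmbOfFin_univ I h, Finset.sum_map]
  rfl

theorem prod_orderEmbOfFin {n k : ℕ} {M : Type*} [CommMonoid M] (I : Finset (Fin n))
    (h : I.card = k) (f : Fin n → M) :
    ∏ j : Fin k, f (I.orderEmbOfFin h j) = ∏ l ∈ I, f l := by
  conv_rhs => rw [← Finset.map_orderEmbOfFin_univ I h, Finset.prod_map]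
  rfl

/-- The Gram determinant of the columns indexed by `I`, weighted by `d`, in terms of the
Plücker coordinate `p_I`. -/
theorem det_sum_eq_plucker_sq_mul_prod {R : Type} [CommRing R] {k n : ℕ}
    (A : Matrix (Fin k) (Fin n) R) (d : Fin n → R) (I : Finset (Fin n)) (h : I.card = k) :
    (Matrix.of fun i j => ∑ l ∈ I, A i l * d l * A j l).det =
      plucker A I ^ 2 * ∏ l ∈ I, d l := by
  have key : (Matrix.of fun i j => ∑ l ∈ I, A i l * d l * A j l) =
      A.submatrix id (I.orderEmbOfFin h) * diagonal (fun j => d (I.orderEmbOfFin h j)) *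
        (A.submatrix id (I.orderEmbOfFin h))ᵀ := by
    ext i j
    rw [Matrix.mul_apply]
    simp [← sum_orderEmbOfFin I h, Matrix.mul_diagonal]
  have hp : plucker A I = (A.submatrix id (I.orderEmbOfFin h)).det := by
    rw [plucker, dif_pos h]
    rfl
  rw [key, det_mul, det_mul, det_transpose, det_diagonal, prod_orderEmbOfFin I h d, hp]
  ring

/-- If the rows of a `k × 2k` matrix span an isotropic subspace for a diagonal form, then the
squares of complementary Plücker coordinates are proportional. -/
theorem plucker_sq_mul_prod_eq_compl {R : Type} [CommRing R] {k : ℕ}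
    (A : Matrix (Fin k) (Fin (2 * k)) R) (d : Fin (2 * k) → R)
    (hA : A * diagonal d * Aᵀ = 0) (I : Finset (Fin (2 * k))) (hI : I.card = k) :
    plucker A I ^ 2 * ∏ l ∈ I, d l = (-1) ^ k * (plucker A Iᶜ ^ 2 * ∏ l ∈ Iᶜ, d l) := by
  have hIc : Iᶜ.card = k := by
    rw [Finset.card_compl, Fintype.card_fin]
    omega
  rw [← det_sum_eq_plucker_sq_mul_prod A d I hI, ← det_sum_eq_plucker_sq_mul_prod A d Iᶜ hIc]
  have hneg : (Matrix.of fun i j => ∑ l ∈ I, A i l * d l * A j l) =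
      -(Matrix.of fun i j => ∑ l ∈ Iᶜ, A i l * d l * A j l) := by
    ext i j
    have hij : ∑ l, A i l * d l * A j l = 0 := by
      have h := congrFun (congrFun hA i) j
      rw [Matrix.mul_apply] at h
      simpa [Matrix.mul_diagonal] using h
    rw [← Finset.sum_add_sum_compl I] at hij
    exact eq_neg_of_add_eq_zero_left hij
  rw [hneg, det_neg, Fintype.card_fin]

/-- Let `S ⊆ {1, …, 2k}` and let `Ω_S` be the diagonal matrix with
`-1` in positions of `S` and `+1` elsewhere.  If `A` is a complex `k × 2k` matrix of
rank `k` with `A * Ω_S * Aᵀ = 0`, then for every `k`-element subset `I`,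
`p_I(A)² = (-1)^{k + |S|} · p_{Iᶜ}(A)²`; in particular the ratio of two complementary
Plücker coordinates is `±1` when `k + |S|` is even and `±√(-1)` when it is odd. -/
theorem statement7 {k : ℕ} (hk : 1 ≤ k) (S : Finset (Fin (2 * k)))
    (A : Matrix (Fin k) (Fin (2 * k)) ℂ) (hrank : A.rank = k)
    (hA : A * Matrix.diagonal (fun i : Fin (2 * k) => if i ∈ S then (-1 : ℂ) else 1) * Aᵀ = 0)
    (I : Finset (Fin (2 * k))) (hI : I.card = k) :
    plucker A I ^ 2 = (-1 : ℂ) ^ (k + S.card) * plucker A Iᶜ ^ 2 := by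
  set d : Fin (2 * k) → ℂ := fun i => if i ∈ S then -1 else 1 with hd
  have hsq : (∏ l ∈ I, d l) * ∏ l ∈ I, d l = 1 := by
    rw [← Finset.prod_mul_distrib]
    exact Finset.prod_eq_one fun l _ => by by_cases hl : l ∈ S <;> simp [hd, hl]
  have hprod : (∏ l ∈ I, d l) * ∏ l ∈ Iᶜ, d l = (-1) ^ S.card := by
    rw [Finset.prod_mul_prod_compl]
    simp [hd]
  have hmain := plucker_sq_mul_prod_eq_compl A d hA I hI
  rw [pow_add, ← hprod]
  linear_combination (∏ l ∈ I, d l) * hmain - plucker A I ^ 2 * hsq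
end

section
/- Let k ≥ 1, let Ω₀ be the 2k×2k diagonal matrix with (Ω₀)_{ii} = (−1)^{i−1}, and let A be a complex k×2k matrix of rank k with A·Ω₀·Aᵀ = 0. Then exactly one of the following holds: p_I(A) = p_{Iᶜ}(A) for every k-element subset I of {1,…,2k}, or p_I(A) = −p_{Iᶜ}(A) for every k-element subset I of {1,…,2k}, where Iᶜ = {1,…,2k}∖I. (These two alternatives correspond to the two connected components of OGr(k,2k).) -/
open Matrix

/-- If `σ` maps everything above `j` to something above `σ j`, then the number of inversions
with larger position `j` has the parity of `j + σ j`. -/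
theorem prod_Iio_inversions_eq {n : ℕ} (σ : Equiv.Perm (Fin n)) (j : Fin n)
    (h : ∀ i, j < i → σ j < σ i) :
    ∏ i ∈ Finset.Iio j, (if σ i < σ j then (1 : ℤˣ) else -1) =
      (-1) ^ ((j : ℕ) + (σ j : ℕ)) := by
  have hcard : ((Finset.Iio j).filter fun i => ¬ σ i < σ j).card + (σ j : ℕ) = j := by
    have hlt : ((Finset.Iio j).filter fun i => σ i < σ j).card = (σ j : ℕ) := by
      rw [← Fin.card_Iio, ← Finset.card_map σ.toEmbedding]
      refine congrArg Finset.card ?_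
      ext i
      simp only [Finset.mem_filter, Finset.mem_Iio, Finset.mem_map_equiv,
        Equiv.apply_symm_apply, and_iff_right_iff_imp]
      intro hi
      by_contra! hji
      rcases hji.eq_or_lt with hji | hji
      · rw [hji, Equiv.apply_symm_apply] at hi
        exact lt_irrefl _ hi
      · simpa using lt_asymm (h _ hji) (by simpa using hi)
    have := Finset.card_filter_add_card_filter_not (s := Finset.Iio j) (fun i => σ i < σ j)
    rw [Fin.card_Iio] at this
    omega
  rw [Finset.prod_ite, Finset.prod_const_one, one_mul, Finset.prod_const]
  rw [← hcard, add_assoc, pow_add, ← two_mul, pow_mul]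
  simp

/-- The sign of the shuffle listing `I` in increasing order and then `Iᶜ` in increasing order. -/
theorem sign_finSumEquivOfFinset {k l : ℕ} (I : Finset (Fin (k + l))) (hI : I.card = k)
    (hJ : Iᶜ.card = l) :
    Equiv.Perm.sign (finSumFinEquiv.symm.trans (finSumEquivOfFinset hI hJ)) =
      ∏ b : Fin l, (-1 : ℤˣ) ^ (k + (b : ℕ) + (Iᶜ.orderEmbOfFin hJ b : ℕ)) := by
  set σ : Equiv.Perm (Fin (k + l)) := finSumFinEquiv.symm.trans (finSumEquivOfFinset hI hJ)
    with hσ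
  have hl (a : Fin k) : σ (Fin.castAdd l a) = I.orderEmbOfFin hI a := by simp [hσ]
  have hr (b : Fin l) : σ (Fin.natAdd k b) = Iᶜ.orderEmbOfFin hJ b := by simp [hσ]
  rw [Equiv.Perm.sign_eq_prod_prod_Iio, Fin.prod_univ_add]
  have hleft (a : Fin k) : ∏ i ∈ Finset.Iio (Fin.castAdd l a),
      (if σ i < σ (Fin.castAdd l a) then (1 : ℤˣ) else -1) = 1 := by
    refine Finset.prod_eq_one fun i hi => if_pos ?_
    induction i using Fin.addCases with
    | left i =>
      rw [hl, hl, OrderEmbedding.lt_iff_lt]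
      have hia := Finset.mem_Iio.1 hi
      rwa [Fin.lt_def, Fin.val_castAdd, Fin.val_castAdd, ← Fin.lt_def] at hia
    | right i =>
      simp only [Finset.mem_Iio, Fin.lt_def, Fin.val_natAdd, Fin.val_castAdd] at hi
      omega
  rw [Finset.prod_congr rfl fun a _ => hleft a, Finset.prod_const_one, one_mul]
  refine Finset.prod_congr rfl fun b _ => ?_
  rw [prod_Iio_inversions_eq, hr, Fin.val_natAdd]
  intro i hi
  induction i using Fin.addCases with
  | left i =>
    simp only [Fin.lt_def, Fin.val_natAdd, Fin.val_castAdd] at hi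
    omega
  | right i =>
    rw [hr, hr, OrderEmbedding.lt_iff_lt]
    simpa using hi

/-- A matrix of full row rank has a nonzero Plücker coordinate. -/
theorem exists_plucker_ne_zero {K : Type} [Field K] {k n : ℕ} (A : Matrix (Fin k) (Fin n) K)
    (hrank : A.rank = k) : ∃ I : Finset (Fin n), I.card = k ∧ plucker A I ≠ 0 := by
  obtain ⟨κ, a, ha, hspan, hli⟩ := exists_linearIndependent' K A.col
  have : Finite κ := Finite.of_injective a ha
  have := Fintype.ofFinite κ
  have hκ : Fintype.card κ = k := by
    rw [← finrank_span_eq_card hli, hspan, ← Matrix.rank_eq_finrank_span_cols, hrank]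
  have hI : (Finset.univ.map ⟨a, ha⟩).card = k := by simpa using hκ
  refine ⟨_, hI, ?_⟩
  have hmem (j : Fin k) : ∃ x, a x = (Finset.univ.map ⟨a, ha⟩).orderEmbOfFin hI j := by
    simpa only [Finset.mem_map, Finset.mem_univ, true_and, Function.Embedding.coeFn_mk] using
      Finset.orderEmbOfFin_mem _ hI j
  choose g hg using hmem
  have hginj : Function.Injective g := fun x y hxy => by
    apply (Finset.orderEmbOfFin _ hI).injective
    rw [← hg, ← hg, hxy]
  rw [plucker, dif_pos hI]
  refine IsUnit.ne_zero ((Matrix.isUnit_iff_isUnit_det _).1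
    (Matrix.linearIndependent_cols_iff_isUnit.1 ?_))
  have hcols : (Matrix.of fun (i j : Fin k) =>
      A i ((Finset.univ.map ⟨a, ha⟩).orderEmbOfFin hI j)).col = (A.col ∘ a) ∘ g := by
    ext j i
    simp [← hg]
  exact hcols ▸ hli.comp g hginj

/-- If the rows of `A` are isotropic for the diagonal form `(-1)^i`, then the ratio
`p_I(A) : p_{Iᶜ}(A)` is the same for all `I`. -/
theorem plucker_mul_eq_of_isotropic {K : Type} [Field K] {k : ℕ}
    (A C : Matrix (Fin k) (Fin (k + k)) K)
    (hA : A * diagonal (fun i : Fin (k + k) => (-1 : K) ^ (i : ℕ)) * Aᵀ = 0) :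
    ∃ α : K, ∀ I : Finset (Fin (k + k)), I.card = k →
      α * plucker A I =
        (A * diagonal (fun i : Fin (k + k) => (-1 : K) ^ (i : ℕ)) * Cᵀ).det *
          (∏ b : Fin k, (-1) ^ (k + (b : ℕ))) * plucker A Iᶜ := by
  set ω : Fin (k + k) → K := fun i => (-1 : K) ^ (i : ℕ) with hω
  refine ⟨(∏ i, ω i) * ((fromRows C A).submatrix id finSumFinEquiv).det, fun I hI => ?_⟩
  have hJ : Iᶜ.card = k := by rw [Finset.card_compl, hI, Fintype.card_fin]; omega
  set e := finSumEquivOfFinset hI hJ with he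
  rw [plucker, dif_pos hI, plucker, dif_pos hJ]
  set AI := Matrix.of fun (i j : Fin k) => A i (I.orderEmbOfFin hI j) with hAI
  set AJ := Matrix.of fun (i j : Fin k) => A i (Iᶜ.orderEmbOfFin hJ j) with hAJ
  set J := Iᶜ.orderEmbOfFin hJ with hJdef
  set E : Matrix (Fin k) (Fin (k + k)) K := (1 : Matrix (Fin (k + k)) (Fin (k + k)) K).submatrix J id
    with hE
  have hprod : (fromRows A E * diagonal ω) * (fromRows C A)ᵀ =
      fromBlocks (A * diagonal ω * Cᵀ) 0 (E * diagonal ω * Cᵀ) (E * diagonal ω * Aᵀ) := by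
    rw [fromRows_mul, transpose_fromRows, fromRows_mul_fromCols, hA]
  have hdetprod := congrArg det hprod
  rw [det_fromBlocks_zero₁₂] at hdetprod
  have hEA : (E * diagonal ω * Aᵀ).det = (∏ b, ω (J b)) * AJ.det := by
    have : E * diagonal ω * Aᵀ = diagonal (fun b => ω (J b)) * AJᵀ := by
      ext b i
      simp [hE, hAJ, Matrix.mul_apply, Matrix.one_apply, diagonal_apply, Finset.sum_ite_eq,
        ite_mul]
    rw [this, det_mul, det_diagonal, det_transpose]
  have hAE : ((fromRows A E).submatrix id e).det = AI.det := by
    have : (fromRows A E).submatrix id e = fromBlocks AI AJ 0 1 := by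
      ext (i | i) (j | j)
      · simp [hAI, he]
      · simp [hAJ, he, hJdef]
      · have hne : J i ≠ I.orderEmbOfFin hI j := fun h =>
          Finset.mem_compl.1 (Finset.orderEmbOfFin_mem _ hJ i)
            (by rw [← hJdef, h]; exact Finset.orderEmbOfFin_mem _ hI j)
        simp [hE, he, hne]
      · simp [hE, he, Matrix.one_apply, ← hJdef]
    rw [this, det_fromBlocks_zero₂₁, det_one, mul_one]
  have hM : ((fromRows C A).submatrix id e).det =
      ((Equiv.Perm.sign (finSumFinEquiv.symm.trans e) : ℤˣ) : K) *
        ((fromRows C A).submatrix id finSumFinEquiv).det := by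
    have hs : Equiv.Perm.sign (finSumFinEquiv.symm.trans e) =
        Equiv.Perm.sign (e.trans finSumFinEquiv.symm) := by
      rw [← Equiv.Perm.sign_symm_trans_trans (e.trans finSumFinEquiv.symm) finSumFinEquiv]
      congr 1
      ext x
      simp
    rw [hs, ← det_permute']
    congr 1
    ext i j
    simp
  have hfactor : ((fromRows A E * diagonal ω) * (fromRows C A)ᵀ) =
      (fromRows A E).submatrix id e * diagonal (fun i => ω (e i)) *
        ((fromRows C A).submatrix id e)ᵀ := by
    ext i j
    rw [mul_apply, mul_apply, ← Equiv.sum_comp e]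
    simp only [mul_diagonal, submatrix_apply, transpose_apply, id]
  have hdiag : ∏ i, ω (e i) = ∏ i, ω i := Equiv.prod_comp e ω
  rw [hfactor, det_mul, det_mul, det_diagonal, det_transpose, hAE, hM, hEA, hdiag,
    sign_finSumEquivOfFinset] at hdetprod
  have hsq : (∏ b : Fin k, (-1 : K) ^ (k + (b : ℕ) + (J b : ℕ))) *
      ∏ b : Fin k, (-1 : K) ^ (k + (b : ℕ) + (J b : ℕ)) = 1 := by
    rw [← Finset.prod_mul_distrib]
    exact Finset.prod_eq_one fun b _ => by rw [← mul_pow]; simp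
  have hsplit : (∏ b : Fin k, (-1 : K) ^ (k + (b : ℕ) + (J b : ℕ))) * ∏ b, ω (J b) =
      ∏ b : Fin k, (-1 : K) ^ (k + (b : ℕ)) := by
    rw [← Finset.prod_mul_distrib]
    refine Finset.prod_congr rfl fun b _ => ?_
    rw [hω, pow_add _ (k + (b : ℕ)), mul_assoc, ← mul_pow]
    simp
  push_cast at hdetprod
  rw [← hsplit]
  linear_combination (∏ b : Fin k, (-1 : K) ^ (k + (b : ℕ) + (J b : ℕ))) * hdetprod -
    AI.det * (∏ i, ω i) * ((fromRows C A).submatrix id finSumFinEquiv).det * hsq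

theorem plucker_compl_xor {k n : ℕ} (hn : n = k + k) (A : Matrix (Fin k) (Fin n) ℂ)
    (hrank : A.rank = k)
    (hA : A * diagonal (fun i : Fin n => (-1 : ℂ) ^ (i : ℕ)) * Aᵀ = 0) :
    Xor (∀ I : Finset (Fin n), I.card = k → plucker A I = plucker A Iᶜ)
         (∀ I : Finset (Fin n), I.card = k → plucker A I = - plucker A Iᶜ) := by
  subst hn
  obtain ⟨I₀, hI₀, hne⟩ := exists_plucker_ne_zero A hrank
  have hcompl (I : Finset (Fin (k + k))) (hI : I.card = k) : Iᶜ.card = k := by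
    rw [Finset.card_compl, hI, Fintype.card_fin]; omega
  set Ω : Matrix (Fin (k + k)) (Fin (k + k)) ℂ := diagonal fun i => (-1 : ℂ) ^ (i : ℕ) with hΩ
  obtain ⟨α, hα⟩ := plucker_mul_eq_of_isotropic A ((Aᴴ)ᵀ * Ω) hA
  have hX : A * Ω * ((Aᴴ)ᵀ * Ω)ᵀ = A * Aᴴ := by
    have hΩΩ : Ω * Ω = 1 := by
      rw [hΩ, diagonal_mul_diagonal, ← diagonal_one]
      congr 1
      ext i
      rw [← mul_pow]
      simp
    rw [transpose_mul, transpose_transpose, hΩ, diagonal_transpose, ← hΩ, Matrix.mul_assoc,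
      ← Matrix.mul_assoc Ω, hΩΩ, Matrix.one_mul]
  have hdet : (A * Aᴴ).det ≠ 0 := by
    refine IsUnit.ne_zero ((isUnit_iff_isUnit_det _).1
      (linearIndependent_cols_iff_isUnit.1 ?_))
    open ComplexOrder in
    rw [linearIndependent_iff_card_eq_finrank_span, Set.finrank,
      ← rank_eq_finrank_span_cols, rank_self_mul_conjTranspose, hrank, Fintype.card_fin]
  rw [← hΩ, hX] at hα
  set β : ℂ := (A * Aᴴ).det * ∏ b : Fin k, (-1) ^ (k + (b : ℕ)) with hβ
  have hβ0 : β ≠ 0 := mul_ne_zero hdet (Finset.prod_ne_zero_iff.2 fun b _ => by simp)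
  have h₁ := hα I₀ hI₀
  have h₂ := hα I₀ᶜ (hcompl I₀ hI₀)
  rw [compl_compl] at h₂
  have hsq : α ^ 2 = β ^ 2 :=
    mul_right_cancel₀ hne (by linear_combination α * h₁ + β * h₂)
  have hnot (h : plucker A I₀ = plucker A I₀ᶜ) (h' : plucker A I₀ = -plucker A I₀ᶜ) : False :=
    hne (by linear_combination (h + h') / 2)
  rcases sq_eq_sq_iff_eq_or_eq_neg.1 hsq with h | h
  · have hall (I : Finset (Fin (k + k))) (hI : I.card = k) : plucker A I = plucker A Iᶜ :=
      mul_left_cancel₀ hβ0 (h ▸ hα I hI)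
    exact Or.inl ⟨hall, fun h' => hnot (hall I₀ hI₀) (h' I₀ hI₀)⟩
  · have hall (I : Finset (Fin (k + k))) (hI : I.card = k) : plucker A I = -plucker A Iᶜ :=
      mul_left_cancel₀ hβ0 (by linear_combination -(hα I hI) + plucker A I * h)
    exact Or.inr ⟨hall, fun h' => hnot (h' I₀ hI₀) (hall I₀ hI₀)⟩

/-- Let `Ω₀` be the `2k × 2k` diagonal matrix with entries
`(-1)^{i-1}` (here `(-1)^i` in zero-based indexing), and let `A` be a complex `k × 2k`
matrix of rank `k` with `A * Ω₀ * Aᵀ = 0`.  Then exactly one of the following holds: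
`p_I(A) = p_{Iᶜ}(A)` for every `k`-element subset `I`, or `p_I(A) = -p_{Iᶜ}(A)` for
every `k`-element subset `I`. -/
theorem statement8 {k : ℕ} (hk : 1 ≤ k)
    (A : Matrix (Fin k) (Fin (2 * k)) ℂ) (hrank : A.rank = k)
    (hA : A * Matrix.diagonal (fun i : Fin (2 * k) => (-1 : ℂ) ^ (i : ℕ)) * Aᵀ = 0) :
    Xor' (∀ I : Finset (Fin (2 * k)), I.card = k → plucker A I = plucker A Iᶜ)
         (∀ I : Finset (Fin (2 * k)), I.card = k → plucker A I = - plucker A Iᶜ) := by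
  exact plucker_compl_xor (two_mul k) A hrank hA
end

section
/- Let k ≥ 1 and n > 2k. The ideal I_{k,n} of the polynomial ring R = ℂ[x_K : K a k-element subset of {1,…,n}] generated by all Grassmann–Plücker polynomials G_{I,J} and all orthogonality polynomials H_{I,J} is a prime ideal. -/
/-- The Plücker variable `x_K` of the polynomial ring `ℂ[x_K : K ∈ C([n],k)]`,
extended by `0` to index sets of the wrong cardinality. -/
noncomputable def Xv (n k : ℕ) (K : Finset (Fin n)) :
    MvPolynomial {K : Finset (Fin n) // K.card = k} ℂ :=
  if h : K.card = k then MvPolynomial.X ⟨K, h⟩ else 0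

/-- The Grassmann–Plücker polynomial `G_{I,J}` for a `(k-1)`-set `I` and a
`(k+1)`-set `J`:
`G_{I,J} = ∑_{j ∈ J∖I} (-1)^{#{j' ∈ J : j' ≤ j} + #{i ∈ I : i > j}} x_{I∪{j}} x_{J∖{j}}`. -/
noncomputable def GP (n k : ℕ) (I J : Finset (Fin n)) :
    MvPolynomial {K : Finset (Fin n) // K.card = k} ℂ :=
  ∑ j ∈ J \ I,
    ((-1 : MvPolynomial {K : Finset (Fin n) // K.card = k} ℂ) ^
        ((J.filter fun j' => j' ≤ j).card + (I.filter fun i => j < i).card)) *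
      Xv n k (insert j I) * Xv n k (J.erase j)

/-- The orthogonality polynomial `H_{I,J}` for `(k-1)`-sets `I, J`:
`H_{I,J} = ∑_{ℓ ∉ I∪J} (-1)^{#{i ∈ I : i > ℓ} + #{j ∈ J : j > ℓ}} x_{I∪{ℓ}} x_{J∪{ℓ}}`. -/
noncomputable def HO (n k : ℕ) (I J : Finset (Fin n)) :
    MvPolynomial {K : Finset (Fin n) // K.card = k} ℂ :=
  ∑ l ∈ (I ∪ J)ᶜ,
    ((-1 : MvPolynomial {K : Finset (Fin n) // K.card = k} ℂ) ^
        ((I.filter fun i => l < i).card + (J.filter fun j => l < j).card)) *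
      Xv n k (insert l I) * Xv n k (insert l J)

/-- The ideal `I_{k,n}` generated by all the Grassmann–Plücker polynomials `G_{I,J}`
and all the orthogonality polynomials `H_{I,J}`; it cuts out the orthogonal
Grassmannian `OGr(k,n)` in the Plücker embedding. -/
noncomputable def Ikn (n k : ℕ) :
    Ideal (MvPolynomial {K : Finset (Fin n) // K.card = k} ℂ) :=
  Ideal.span
    ({f | ∃ I J : Finset (Fin n), I.card = k - 1 ∧ J.card = k + 1 ∧ f = GP n k I J} ∪
     {f | ∃ I J : Finset (Fin n), I.card = k - 1 ∧ J.card = k - 1 ∧ f = HO n k I J})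

namespace OrthogonalGrassmannian

open Matrix (vecCons)

/-- The polynomial ring in the Plücker coordinates `x_K`. -/
abbrev PlRing (n k : ℕ) := MvPolynomial {K : Finset (Fin n) // K.card = k} ℂ

/-- The standard basis vector `e_i` of `ℂⁿ`. -/
abbrev stdVec {n : ℕ} (i : Fin n) : Fin n → ℂ := Pi.single i 1

/-- The family of standard basis vectors indexed by a tuple. -/
abbrev stdFam {n k : ℕ} (g : Fin k → Fin n) : Fin k → Fin n → ℂ := fun a => stdVec (g a)

/-- The increasing enumeration of a `k`-element set. -/
abbrev enum {n k : ℕ} (K : {K : Finset (Fin n) // K.card = k}) : Fin k → Fin n :=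
  K.1.orderEmbOfFin K.2

section AlternatingMaps

variable {n k : ℕ} {N : Type*} [AddCommGroup N] [Module ℂ N]

lemma alternatingMap_sum_apply {ι : Type*} (s : Finset ι)
    (f : ι → (Fin n → ℂ) [⋀^Fin k]→ₗ[ℂ] N) (v : Fin k → Fin n → ℂ) :
    (∑ i ∈ s, f i) v = ∑ i ∈ s, f i v := by
  classical
  induction s using Finset.induction_on with
  | empty => simp
  | insert a s ha ih => simp [Finset.sum_insert ha, ih]

lemma enum_injective (K : {K : Finset (Fin n) // K.card = k}) : Function.Injective (enum K) :=
  (K.1.orderEmbOfFin K.2).injective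

lemma exists_perm_enum (g : Fin k → Fin n) (hg : Function.Injective g) :
    ∃ (K : {K : Finset (Fin n) // K.card = k}) (σ : Equiv.Perm (Fin k)),
      K.1 = Finset.univ.image g ∧ g = enum K ∘ σ := by
  have hcard : (Finset.univ.image g).card = k := by
    rw [Finset.card_image_of_injective _ hg, Finset.card_univ, Fintype.card_fin]
  let K : {K : Finset (Fin n) // K.card = k} := ⟨Finset.univ.image g, hcard⟩
  have hmem : ∀ a, ∃ b, enum K b = g a := fun a => by
    have : g a ∈ Set.range (K.1.orderEmbOfFin K.2) := by
      rw [Finset.range_orderEmbOfFin]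
      simp [K]
    exact this
  choose σ hσ using hmem
  have hinj : Function.Injective σ := fun a b h => hg (by rw [← hσ a, ← hσ b, h])
  exact ⟨K, Equiv.ofBijective σ (Finite.injective_iff_bijective.mp hinj), rfl,
    funext fun a => (hσ a).symm⟩

/-- An alternating map takes values in a submodule as soon as it does so on increasing families
of standard basis vectors. -/
lemma alternatingMap_mem (S : Submodule ℂ N) (f : (Fin n → ℂ) [⋀^Fin k]→ₗ[ℂ] N)
    (h : ∀ K, f (stdFam (enum K)) ∈ S) (v : Fin k → Fin n → ℂ) : f v ∈ S := by
  have h0 : S.mkQ.compAlternatingMap f = 0 := by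
    refine Module.Basis.ext_alternating (Pi.basisFun ℂ (Fin n)) fun g hg => ?_
    obtain ⟨K, σ, -, hK⟩ := exists_perm_enum g hg
    have h1 : (fun i => Pi.basisFun ℂ (Fin n) (g i)) = stdFam (enum K) ∘ σ := by
      funext i
      rw [hK]
      simp
    rw [h1, AlternatingMap.map_perm]
    have : (S.mkQ.compAlternatingMap f) (stdFam (enum K)) = 0 := by
      simpa using h K
    rw [this]
    simp
  have := DFunLike.congr_fun h0 v
  simpa using this

lemma alternatingMap_ext_enum {f f' : (Fin n → ℂ) [⋀^Fin k]→ₗ[ℂ] N}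
    (h : ∀ K, f (stdFam (enum K)) = f' (stdFam (enum K))) : f = f' := by
  ext v
  have := alternatingMap_mem (⊥ : Submodule ℂ N) (f - f') (fun K => by simp [h K]) v
  simpa [sub_eq_zero] using this

/-- The universal alternating map, sending `v` to the linear form whose coefficients are the
maximal minors of `v`. -/
noncomputable def plucker (n k : ℕ) : (Fin n → ℂ) [⋀^Fin k]→ₗ[ℂ] PlRing n k :=
  ∑ K : {K : Finset (Fin n) // K.card = k},
    (LinearMap.toSpanSingleton ℂ (PlRing n k) (MvPolynomial.X K)).compAlternatingMap
      (Matrix.detRowAlternating.compLinearMap (LinearMap.funLeft ℂ ℂ (enum K)))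

lemma plucker_apply (v : Fin k → Fin n → ℂ) :
    plucker n k v = ∑ K : {K : Finset (Fin n) // K.card = k},
      Matrix.det (Matrix.of fun a b => v a (enum K b)) • (MvPolynomial.X K : PlRing n k) := by
  simp only [plucker, alternatingMap_sum_apply]
  rfl

lemma plucker_enum (K : {K : Finset (Fin n) // K.card = k}) :
    plucker n k (stdFam (enum K)) = MvPolynomial.X K := by
  rw [plucker_apply, Finset.sum_eq_single K]
  · have : Matrix.of (fun a b => stdFam (enum K) a (enum K b)) =
        (1 : Matrix (Fin k) (Fin k) ℂ) := by
      ext a b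
      simp [Matrix.one_apply, Pi.single_apply, eq_comm]
    rw [this]
    simp
  · intro L _ hL
    have : ∃ a, enum K a ∉ L.1 := by
      by_contra! hcon
      apply hL
      have hsub : K.1 ⊆ L.1 := fun x hx => by
        have : x ∈ Set.range (K.1.orderEmbOfFin K.2) := by
          rwa [Finset.range_orderEmbOfFin]
        obtain ⟨a, rfl⟩ := this
        exact hcon a
      exact (Subtype.ext (Finset.eq_of_subset_of_card_le hsub (by rw [K.2, L.2]))).symm
    obtain ⟨a, ha⟩ := this
    rw [Matrix.det_eq_zero_of_row_eq_zero a, zero_smul]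
    intro b
    have hne : enum L b ≠ enum K a := fun h => ha (h ▸ Finset.orderEmbOfFin_mem _ _ _)
    simp [Pi.single_apply, hne]
  · simp

/-- On a tuple of standard basis vectors `plucker` is zero or a variable up to sign. -/
lemma plucker_stdFam (g : Fin k → Fin n) :
    plucker n k (stdFam g) = 0 ∨
      ∃ (K : {K : Finset (Fin n) // K.card = k}) (ε : ℤˣ), Function.Injective g ∧
        K.1 = Finset.univ.image g ∧ plucker n k (stdFam g) = ε • MvPolynomial.X K := by
  by_cases hg : Function.Injective g
  · obtain ⟨K, σ, hK, hgK⟩ := exists_perm_enum g hg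
    refine Or.inr ⟨K, Equiv.Perm.sign σ, hg, hK, ?_⟩
    rw [← plucker_enum K, ← AlternatingMap.map_perm]
    congr 1
    rw [hgK]
    rfl
  · left
    apply AlternatingMap.map_eq_zero_of_not_injective
    intro h
    exact hg fun a b hab => h (congrArg stdVec hab)

lemma plucker_cons_removeNth (i : Fin (k + 1)) (x : Fin n → ℂ) (v : Fin (k + 1) → Fin n → ℂ) :
    plucker n (k + 1) (vecCons x (i.removeNth v)) =
      (-1) ^ (i : ℕ) * plucker n (k + 1) (Function.update v i x) := by
  rw [← AlternatingMap.neg_one_pow_smul_map_insertNth, Fin.insertNth_removeNth,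
    zsmul_eq_mul]
  push_cast
  rfl

end AlternatingMaps

section Relations

variable {n k : ℕ}

/-- The Plücker relation attached to two families of vectors. -/
noncomputable def pluckerRel (u : Fin k → Fin n → ℂ) :
    (Fin n → ℂ) [⋀^Fin (k + 2)]→ₗ[ℂ] PlRing n (k + 1) :=
  AlternatingMap.alternatizeUncurryFin
    { toFun := fun x =>
        (LinearMap.mulLeft ℂ (plucker n (k + 1) (vecCons x u))).compAlternatingMap
          (plucker n (k + 1))
      map_add' := fun x y => by
        refine AlternatingMap.ext fun w => ?_
        simp [AlternatingMap.map_vecCons_add, add_mul]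
      map_smul' := fun c x => by
        refine AlternatingMap.ext fun w => ?_
        simp [AlternatingMap.map_vecCons_smul] }

lemma pluckerRel_apply (u : Fin k → Fin n → ℂ) (w : Fin (k + 2) → Fin n → ℂ) :
    pluckerRel u w = ∑ j : Fin (k + 2), (-1) ^ (j : ℕ) *
      (plucker n (k + 1) (vecCons (w j) u) * plucker n (k + 1) (j.removeNth w)) := by
  rw [pluckerRel, AlternatingMap.alternatizeUncurryFin_apply]
  refine Finset.sum_congr rfl fun j _ => ?_
  simp only [zsmul_eq_mul]
  push_cast
  rfl

/-- The orthogonality relation attached to two families of vectors and the bilinear form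
`∑ l, e_l ⊗ e_{τ l}`. -/
noncomputable def orthRel (τ : Fin n → Fin n) (u w : Fin k → Fin n → ℂ) : PlRing n (k + 1) :=
  ∑ l, plucker n (k + 1) (vecCons (stdVec l) u) * plucker n (k + 1) (vecCons (stdVec (τ l)) w)

/-- The ideal generated by all Plücker and orthogonality relations. -/
noncomputable def relIdeal (n k : ℕ) (τ : Fin n → Fin n) : Ideal (PlRing n (k + 1)) :=
  Ideal.span ({f | ∃ u w, f = pluckerRel (n := n) (k := k) u w} ∪
    {f | ∃ u w, f = orthRel (k := k) τ u w})

lemma pluckerRel_mem (τ : Fin n → Fin n) (u : Fin k → Fin n → ℂ) (w : Fin (k + 2) → Fin n → ℂ) :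
    pluckerRel u w ∈ relIdeal n k τ :=
  Ideal.subset_span (Or.inl ⟨u, w, rfl⟩)

lemma orthRel_mem (τ : Fin n → Fin n) (u w : Fin k → Fin n → ℂ) :
    orthRel τ u w ∈ relIdeal n k τ :=
  Ideal.subset_span (Or.inr ⟨u, w, rfl⟩)

/-- It suffices to check that the relations of increasing families of standard basis vectors lie
in an ideal. -/
lemma relIdeal_le_of_enum (τ : Fin n → Fin n) (S : Ideal (PlRing n (k + 1)))
    (hG : ∀ (I : {K : Finset (Fin n) // K.card = k}) (J : {K : Finset (Fin n) // K.card = k + 2}),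
      pluckerRel (stdFam (enum I)) (stdFam (enum J)) ∈ S)
    (hH : ∀ I J : {K : Finset (Fin n) // K.card = k},
      orthRel τ (stdFam (enum I)) (stdFam (enum J)) ∈ S) :
    relIdeal n k τ ≤ S := by
  rw [relIdeal, Ideal.span_le]
  rintro f (⟨u, w, rfl⟩ | ⟨u, w, rfl⟩)
  · refine alternatingMap_mem (S.restrictScalars ℂ) (pluckerRel u) (fun J => ?_) w
    let F : (Fin n → ℂ) [⋀^Fin k]→ₗ[ℂ] PlRing n (k + 1) :=
      ∑ j : Fin (k + 2), (LinearMap.mulLeft ℂ ((-1) ^ (j : ℕ) *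
        plucker n (k + 1) (j.removeNth (stdFam (enum J))))).compAlternatingMap
          ((plucker n (k + 1)).curryLeft (stdFam (enum J) j))
    have hF : ∀ u, F u = pluckerRel u (stdFam (enum J)) := fun u => by
      rw [pluckerRel_apply]
      simp only [F, alternatingMap_sum_apply]
      refine Finset.sum_congr rfl fun j _ => ?_
      simp only [LinearMap.compAlternatingMap_apply, LinearMap.mulLeft_apply,
        AlternatingMap.curryLeft_apply_apply]
      ring
    rw [← hF]
    exact alternatingMap_mem _ F (fun I => by rw [hF]; exact hG I J) u
  · let F (u : Fin k → Fin n → ℂ) : (Fin n → ℂ) [⋀^Fin k]→ₗ[ℂ] PlRing n (k + 1) :=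
      ∑ l : Fin n, (LinearMap.mulLeft ℂ
        (plucker n (k + 1) (vecCons (stdVec l) u))).compAlternatingMap
          ((plucker n (k + 1)).curryLeft (stdVec (τ l)))
    have hF : ∀ u w, F u w = orthRel τ u w := fun u w => by
      simp [F, orthRel, alternatingMap_sum_apply]
    let F' (w : Fin k → Fin n → ℂ) : (Fin n → ℂ) [⋀^Fin k]→ₗ[ℂ] PlRing n (k + 1) :=
      ∑ l : Fin n, (LinearMap.mulLeft ℂ
        (plucker n (k + 1) (vecCons (stdVec (τ l)) w))).compAlternatingMap
          ((plucker n (k + 1)).curryLeft (stdVec l))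
    have hF' : ∀ u w, F' w u = orthRel τ u w := fun u w => by
      simp [F', orthRel, alternatingMap_sum_apply, mul_comm]
    rw [← hF]
    refine alternatingMap_mem (S.restrictScalars ℂ) (F u) (fun J => ?_) w
    rw [hF, ← hF']
    refine alternatingMap_mem (S.restrictScalars ℂ) (F' _) (fun I => ?_) u
    rw [hF']
    exact hH I J

/-- The exchange form of the Plücker relations. -/
lemma exchange_mem (τ : Fin n → Fin n) (u w : Fin (k + 1) → Fin n → ℂ) (i : Fin (k + 1)) :
    (∑ j, plucker n (k + 1) (Function.update u i (w j)) *
        plucker n (k + 1) (Function.update w j (u i))) -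
      plucker n (k + 1) u * plucker n (k + 1) w ∈ relIdeal n k τ := by
  have h := pluckerRel_mem τ (i.removeNth u) (vecCons (u i) w)
  have key : pluckerRel (i.removeNth u) (vecCons (u i) w) = (-1) ^ ((i : ℕ) + 1) *
      ((∑ j, plucker n (k + 1) (Function.update u i (w j)) *
        plucker n (k + 1) (Function.update w j (u i))) -
      plucker n (k + 1) u * plucker n (k + 1) w) := by
    have h0 : ((0 : Fin (k + 2)).removeNth (vecCons (u i) w) : Fin (k + 1) → Fin n → ℂ) = w := by
      funext a
      simp [Fin.removeNth]
    have hsucc : ∀ j : Fin (k + 1),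
        (j.succ.removeNth (vecCons (u i) w) : Fin (k + 1) → Fin n → ℂ) =
          vecCons (u i) (j.removeNth w) := fun j => by
      funext a
      refine Fin.cases ?_ (fun b => ?_) a <;> simp [Fin.removeNth]
    have hterm : ∀ j : Fin (k + 1), (-1 : PlRing n (k + 1)) ^ ((j.succ : Fin (k + 2)) : ℕ) *
        (plucker n (k + 1) (vecCons (vecCons (u i) w j.succ) (i.removeNth u)) *
          plucker n (k + 1) (j.succ.removeNth (vecCons (u i) w))) =
        (-1) ^ ((i : ℕ) + 1) * (plucker n (k + 1) (Function.update u i (w j)) *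
          plucker n (k + 1) (Function.update w j (u i))) := fun j => by
      rw [hsucc, plucker_cons_removeNth, plucker_cons_removeNth, Matrix.cons_val_succ,
        Fin.val_succ]
      have h2 : ((-1 : PlRing n (k + 1)) ^ (j : ℕ)) * (-1) ^ (j : ℕ) = 1 := by
        rw [← mul_pow, neg_one_mul, neg_neg, one_pow]
      linear_combination (-(-1) ^ (i : ℕ) * plucker n (k + 1) (Function.update u i (w j)) *
        plucker n (k + 1) (Function.update w j (u i))) * h2
    rw [pluckerRel_apply, Fin.sum_univ_succ, Finset.sum_congr rfl fun j _ => hterm j,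
      ← Finset.mul_sum, plucker_cons_removeNth, h0, Matrix.cons_val_zero,
      Function.update_eq_self, Fin.val_zero]
    ring
  rw [key] at h
  have h3 := Ideal.mul_mem_left _ ((-1) ^ ((i : ℕ) + 1)) h
  rwa [← mul_assoc, ← mul_pow, neg_one_mul, neg_neg, one_pow, one_mul] at h3

end Relations

section Comparison

variable {n k : ℕ}

lemma Xv_eq_X (K : {K : Finset (Fin n) // K.card = k}) : Xv n k K.1 = MvPolynomial.X K := by
  simp [Xv, K.2]

lemma card_filter_lt_enum (K : {K : Finset (Fin n) // K.card = k}) (q : Fin k) :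
    (K.1.filter fun x => x < enum K q).card = q := by
  have : (K.1.filter fun x => x < enum K q) =
      (Finset.Iio q).map (K.1.orderEmbOfFin K.2).toEmbedding := by
    ext x
    simp only [Finset.mem_filter, Finset.mem_map, Finset.mem_Iio]
    constructor
    · rintro ⟨hx, hlt⟩
      have hx' : x ∈ Set.range (K.1.orderEmbOfFin K.2) := by rwa [Finset.range_orderEmbOfFin]
      obtain ⟨a, rfl⟩ := hx'
      exact ⟨a, by simpa using hlt, rfl⟩
    · rintro ⟨a, ha, rfl⟩
      exact ⟨Finset.orderEmbOfFin_mem _ _ _, by simpa using ha⟩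
  rw [this, Finset.card_map, Fin.card_Iio]

lemma exists_enum_eq (K : {K : Finset (Fin n) // K.card = k}) {x : Fin n} (hx : x ∈ K.1) :
    ∃ q, enum K q = x := by
  have hx' : x ∈ Set.range (K.1.orderEmbOfFin K.2) := by rwa [Finset.range_orderEmbOfFin]
  exact hx'

lemma enum_erase (K : {K : Finset (Fin n) // K.card = k + 1}) (q : Fin (k + 1))
    (L : {K : Finset (Fin n) // K.card = k}) (hL : L.1 = K.1.erase (enum K q)) :
    enum L = q.removeNth (enum K) := by
  refine (Finset.orderEmbOfFin_unique L.2 (fun a => ?_) ?_).symm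
  · rw [hL, Finset.mem_erase]
    refine ⟨fun h => ?_, Finset.orderEmbOfFin_mem _ _ _⟩
    exact Fin.succAbove_ne q a (enum_injective K h)
  · exact (K.1.orderEmbOfFin K.2).strictMono.removeNth q

lemma card_filter_gt_add {I : Finset (Fin n)} {l : Fin n} (hl : l ∉ I) :
    (I.filter fun i => l < i).card + (I.filter fun i => i < l).card = I.card := by
  rw [← Finset.card_filter_add_card_filter_not (s := I) (fun i => l < i)]
  congr 2
  ext i
  simp only [Finset.mem_filter, not_lt, and_congr_right_iff]
  intro hi
  exact ⟨le_of_lt, fun h => lt_of_le_of_ne h fun h' => hl (h' ▸ hi)⟩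

lemma plucker_cons_enum (I : {K : Finset (Fin n) // K.card = k}) (l : Fin n) :
    plucker n (k + 1) (vecCons (stdVec l) (stdFam (enum I))) =
      if l ∈ I.1 then 0 else
        (-1) ^ (k + (I.1.filter fun i => l < i).card) * Xv n (k + 1) (insert l I.1) := by
  split_ifs with hl
  · obtain ⟨q, hq⟩ := exists_enum_eq I hl
    refine AlternatingMap.map_eq_zero_of_eq _ _ (i := 0) (j := q.succ) ?_ (Fin.succ_ne_zero q).symm
    simp only [Matrix.cons_val_zero, Matrix.cons_val_succ, stdFam, hq]
  · let K : {K : Finset (Fin n) // K.card = k + 1} :=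
      ⟨insert l I.1, by rw [Finset.card_insert_of_notMem hl, I.2]⟩
    obtain ⟨q, hq⟩ := exists_enum_eq K (x := l) (Finset.mem_insert_self _ _)
    have hI : enum I = q.removeNth (enum K) := enum_erase K q I (by
      rw [hq]
      exact (Finset.erase_insert hl).symm)
    have hcard : (I.1.filter fun i => i < l).card = q := by
      rw [← card_filter_lt_enum K q, hq]
      simp [K, Finset.filter_insert]
    have h1 : stdFam (enum I) = q.removeNth (stdFam (enum K)) := by
      rw [hI]
      rfl
    have h2 : Function.update (stdFam (enum K)) q (stdVec l) = stdFam (enum K) := by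
      rw [← hq]
      exact Function.update_eq_self _ _
    rw [h1, plucker_cons_removeNth, h2, plucker_enum, ← Xv_eq_X, ← hcard]
    have h3 := card_filter_gt_add hl
    rw [I.2] at h3
    congr 1
    generalize (I.1.filter fun i => l < i).card = a at *
    generalize (I.1.filter fun i => i < l).card = b at *
    rw [← h3, show a + b + a = b + 2 * a by ring, pow_add, pow_mul]
    simp

lemma pluckerRel_enum (I : {K : Finset (Fin n) // K.card = k})
    (J : {K : Finset (Fin n) // K.card = k + 2}) :
    pluckerRel (stdFam (enum I)) (stdFam (enum J)) = (-1) ^ (k + 1) * GP n (k + 1) I.1 J.1 := by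
  have hJ : J.1 = Finset.univ.map (J.1.orderEmbOfFin J.2).toEmbedding :=
    (Finset.map_orderEmbOfFin_univ _ _).symm
  have hGP : GP n (k + 1) I.1 J.1 = ∑ j ∈ J.1, if j ∈ I.1 then 0 else
      ((-1 : PlRing n (k + 1)) ^ ((J.1.filter fun j' => j' ≤ j).card +
        (I.1.filter fun i => j < i).card)) * Xv n (k + 1) (insert j I.1) *
          Xv n (k + 1) (J.1.erase j) := by
    rw [GP, Finset.sum_ite, Finset.sum_const_zero, zero_add, Finset.sdiff_eq_filter]
  have hsum : ∀ F : Fin n → PlRing n (k + 1), ∑ j ∈ J.1, F j = ∑ q, F (enum J q) := fun F => by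
    conv_lhs => rw [hJ]
    rw [Finset.sum_map]
    rfl
  rw [pluckerRel_apply, hGP, hsum, Finset.mul_sum]
  refine Finset.sum_congr rfl fun q _ => ?_
  rw [plucker_cons_enum]
  split_ifs with hl
  · simp
  · let L : {K : Finset (Fin n) // K.card = k + 1} :=
      ⟨J.1.erase (enum J q), by
        rw [Finset.card_erase_of_mem (Finset.orderEmbOfFin_mem _ _ _), J.2]; rfl⟩
    have h1 : q.removeNth (stdFam (enum J)) = stdFam (enum L) := by
      rw [enum_erase J q L rfl]
      rfl
    have hcard : (J.1.filter fun j' => j' ≤ enum J q).card = q + 1 := by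
      have : (J.1.filter fun j' => j' ≤ enum J q) =
          insert (enum J q) (J.1.filter fun j' => j' < enum J q) := by
        ext x
        simp only [Finset.mem_filter, Finset.mem_insert, le_iff_lt_or_eq]
        constructor
        · rintro ⟨h1, h2 | h2⟩
          · exact Or.inr ⟨h1, h2⟩
          · exact Or.inl h2
        · rintro (rfl | ⟨h1, h2⟩)
          · exact ⟨Finset.orderEmbOfFin_mem _ _ _, Or.inr rfl⟩
          · exact ⟨h1, Or.inl h2⟩
      rw [this, Finset.card_insert_of_notMem (by simp), card_filter_lt_enum]
    rw [h1, plucker_enum, ← Xv_eq_X, hcard]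
    have h2 : ((-1 : PlRing n (k + 1)) ^ 2) = 1 := by simp
    simp only [pow_add, pow_one]
    ring

lemma orthRel_enum (I J : {K : Finset (Fin n) // K.card = k}) :
    orthRel id (stdFam (enum I)) (stdFam (enum J)) = HO n (k + 1) I.1 J.1 := by
  have hHO : HO n (k + 1) I.1 J.1 = ∑ l, if l ∈ I.1 ∪ J.1 then 0 else
      ((-1 : PlRing n (k + 1)) ^ ((I.1.filter fun i => l < i).card +
        (J.1.filter fun j => l < j).card)) * Xv n (k + 1) (insert l I.1) *
          Xv n (k + 1) (insert l J.1) := by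
    rw [HO, Finset.sum_ite, Finset.sum_const_zero, zero_add, Finset.compl_eq_univ_sdiff,
      Finset.sdiff_eq_filter]
  rw [orthRel, hHO]
  refine Finset.sum_congr rfl fun l _ => ?_
  rw [plucker_cons_enum, id, plucker_cons_enum]
  by_cases h1 : l ∈ I.1
  · simp [h1]
  by_cases h2 : l ∈ J.1
  · simp [h2]
  rw [if_neg h1, if_neg h2, if_neg (by simp [h1, h2])]
  have h3 : ((-1 : PlRing n (k + 1)) ^ k) * (-1) ^ k = 1 := by
    rw [← mul_pow, neg_one_mul, neg_neg, one_pow]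
  simp only [pow_add]
  linear_combination ((-1) ^ (I.1.filter fun i => l < i).card *
    (-1) ^ (J.1.filter fun j => l < j).card * Xv n (k + 1) (insert l I.1) *
          Xv n (k + 1) (insert l J.1)) * h3

lemma Ikn_eq_relIdeal (n k : ℕ) : Ikn n (k + 1) = relIdeal n k id := by
  apply le_antisymm
  · rw [Ikn, Ideal.span_le]
    rintro f (⟨I, J, hI, hJ, rfl⟩ | ⟨I, J, hI, hJ, rfl⟩)
    · rw [Nat.add_sub_cancel] at hI
      have h := Ideal.mul_mem_left _ ((-1) ^ (k + 1)) (pluckerRel_mem id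
        (stdFam (enum ⟨I, hI⟩)) (stdFam (enum ⟨J, hJ⟩)))
      rwa [pluckerRel_enum, ← mul_assoc, ← mul_pow, neg_one_mul, neg_neg, one_pow, one_mul] at h
    · rw [Nat.add_sub_cancel] at hI hJ
      have h := orthRel_mem id (stdFam (enum ⟨I, hI⟩)) (stdFam (enum ⟨J, hJ⟩))
      rwa [orthRel_enum] at h
  · refine relIdeal_le_of_enum _ _ (fun I J => ?_) (fun I J => ?_)
    · rw [pluckerRel_enum]
      exact Ideal.mul_mem_left _ _ (Ideal.subset_span (Or.inl ⟨I.1, J.1, I.2, J.2, rfl⟩))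
    · rw [orthRel_enum]
      exact Ideal.subset_span (Or.inr ⟨I.1, J.1, I.2, J.2, rfl⟩)

end Comparison

section ChangeOfCoordinates

variable {n k : ℕ}

/-- The algebra endomorphism of the Plücker ring induced by a linear endomorphism of `ℂⁿ`. -/
noncomputable def inducedHom (k : ℕ) (A : (Fin n → ℂ) →ₗ[ℂ] (Fin n → ℂ)) :
    PlRing n k →ₐ[ℂ] PlRing n k :=
  MvPolynomial.aeval fun K => plucker n k (A ∘ stdFam (enum K))

lemma inducedHom_plucker (A : (Fin n → ℂ) →ₗ[ℂ] (Fin n → ℂ)) (v : Fin k → Fin n → ℂ) :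
    inducedHom k A (plucker n k v) = plucker n k (A ∘ v) := by
  have : (inducedHom k A).toLinearMap.compAlternatingMap (plucker n k) =
      (plucker n k).compLinearMap A := by
    refine alternatingMap_ext_enum fun K => ?_
    simp only [LinearMap.compAlternatingMap_apply, plucker_enum, AlgHom.toLinearMap_apply,
      inducedHom, MvPolynomial.aeval_X, AlternatingMap.compLinearMap_apply]
    rfl
  exact DFunLike.congr_fun this v

lemma inducedHom_comp_apply {A B : (Fin n → ℂ) →ₗ[ℂ] (Fin n → ℂ)} (h : A ∘ₗ B = LinearMap.id)
    (f : PlRing n k) : inducedHom k A (inducedHom k B f) = f := by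
  have : (inducedHom k A).comp (inducedHom k B) = AlgHom.id ℂ _ := by
    refine MvPolynomial.algHom_ext fun K => ?_
    rw [AlgHom.comp_apply, ← plucker_enum, inducedHom_plucker, inducedHom_plucker,
      ← Function.comp_assoc, ← LinearMap.coe_comp, h]
    rfl
  exact DFunLike.congr_fun this f

lemma comp_vecCons (A : (Fin n → ℂ) →ₗ[ℂ] (Fin n → ℂ)) (x : Fin n → ℂ) (u : Fin k → Fin n → ℂ) :
    A ∘ vecCons x u = vecCons (A x) (A ∘ u) := by
  funext a
  refine Fin.cases ?_ (fun b => ?_) a <;> simp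

lemma inducedHom_pluckerRel (A : (Fin n → ℂ) →ₗ[ℂ] (Fin n → ℂ)) (u : Fin k → Fin n → ℂ)
    (w : Fin (k + 2) → Fin n → ℂ) :
    inducedHom (k + 1) A (pluckerRel u w) = pluckerRel (A ∘ u) (A ∘ w) := by
  rw [pluckerRel_apply, pluckerRel_apply, map_sum]
  refine Finset.sum_congr rfl fun j _ => ?_
  rw [map_mul, map_mul, inducedHom_plucker, inducedHom_plucker, comp_vecCons]
  simp only [map_pow, map_neg, map_one]
  rfl

/-- The linear map `a • 1 + b • (e_l ↦ e_{rev l})`. -/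
noncomputable def revComb (n : ℕ) (a b : ℂ) : (Fin n → ℂ) →ₗ[ℂ] (Fin n → ℂ) :=
  a • LinearMap.id + b • LinearMap.funLeft ℂ ℂ Fin.rev

lemma revComb_stdVec (a b : ℂ) (l : Fin n) :
    revComb n a b (stdVec l) = a • stdVec l + b • stdVec l.rev := by
  have : (LinearMap.funLeft ℂ ℂ Fin.rev) (stdVec l) = stdVec l.rev := by
    funext x
    simp [LinearMap.funLeft_apply, Pi.single_apply, Fin.rev_eq_iff]
  simp [revComb, this]

lemma revComb_comp (a b c d : ℂ) :
    revComb n a b ∘ₗ revComb n c d = revComb n (a * c + b * d) (a * d + b * c) := by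
  ext l x
  simp only [LinearMap.comp_apply, LinearMap.single_apply]
  rw [revComb_stdVec, map_add, map_smul, map_smul, revComb_stdVec, revComb_stdVec,
    revComb_stdVec, Fin.rev_rev]
  simp only [Pi.add_apply, Pi.smul_apply, smul_eq_mul]
  ring

lemma inducedHom_orthRel_id {a b : ℂ} (h0 : a ^ 2 + b ^ 2 = 0) (h1 : 2 * (a * b) = 1)
    (u w : Fin k → Fin n → ℂ) :
    inducedHom (k + 1) (revComb n a b) (orthRel id u w) =
      orthRel Fin.rev (revComb n a b ∘ u) (revComb n a b ∘ w) := by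
  simp only [orthRel, map_sum, map_mul, inducedHom_plucker, comp_vecCons, revComb_stdVec,
    AlternatingMap.map_vecCons_add, AlternatingMap.map_vecCons_smul, id]
  generalize revComb n a b ∘ u = u'
  generalize revComb n a b ∘ w = w'
  have hr : ∀ F : Fin n → PlRing n (k + 1), ∑ l, F (Fin.rev l) = ∑ l, F l := fun F =>
    Equiv.sum_comp Fin.revPerm F
  let S (l m : Fin n) := plucker n (k + 1) (vecCons (stdVec l) u') *
    plucker n (k + 1) (vecCons (stdVec m) w')
  have key : ∀ l : Fin n, (a • plucker n (k + 1) (vecCons (stdVec l) u') +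
      b • plucker n (k + 1) (vecCons (stdVec l.rev) u')) *
      (a • plucker n (k + 1) (vecCons (stdVec l) w') +
      b • plucker n (k + 1) (vecCons (stdVec l.rev) w')) =
      a ^ 2 • S l l + b ^ 2 • S l.rev l.rev + (a * b) • (S l l.rev + S l.rev l.rev.rev) := by
    intro l
    simp only [S, MvPolynomial.smul_eq_C_mul, map_pow, map_mul, Fin.rev_rev]
    ring
  rw [Finset.sum_congr rfl fun l _ => key l, Finset.sum_add_distrib, Finset.sum_add_distrib,
    ← Finset.smul_sum, ← Finset.smul_sum, ← Finset.smul_sum, Finset.sum_add_distrib,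
    hr fun l => S l l, hr fun l => S l l.rev, ← add_smul, h0, zero_smul, zero_add, ← two_smul ℂ,
    smul_smul, mul_comm _ (2 : ℂ), h1, one_smul]

lemma inducedHom_orthRel_rev {a b : ℂ} (h0 : a ^ 2 + b ^ 2 = 0) (h1 : 2 * (a * b) = 1)
    (u w : Fin k → Fin n → ℂ) :
    inducedHom (k + 1) (revComb n a b) (orthRel Fin.rev u w) =
      orthRel id (revComb n a b ∘ u) (revComb n a b ∘ w) := by
  simp only [orthRel, map_sum, map_mul, inducedHom_plucker, comp_vecCons, revComb_stdVec,
    AlternatingMap.map_vecCons_add, AlternatingMap.map_vecCons_smul, id, Fin.rev_rev]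
  generalize revComb n a b ∘ u = u'
  generalize revComb n a b ∘ w = w'
  have hr : ∀ F : Fin n → PlRing n (k + 1), ∑ l, F (Fin.rev l) = ∑ l, F l := fun F =>
    Equiv.sum_comp Fin.revPerm F
  let S (l m : Fin n) := plucker n (k + 1) (vecCons (stdVec l) u') *
    plucker n (k + 1) (vecCons (stdVec m) w')
  have key : ∀ l : Fin n, (a • plucker n (k + 1) (vecCons (stdVec l) u') +
      b • plucker n (k + 1) (vecCons (stdVec l.rev) u')) *
      (a • plucker n (k + 1) (vecCons (stdVec l.rev) w') +
      b • plucker n (k + 1) (vecCons (stdVec l) w')) =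
      a ^ 2 • S l l.rev + b ^ 2 • S l.rev l.rev.rev + (a * b) • (S l l + S l.rev l.rev) := by
    intro l
    simp only [S, MvPolynomial.smul_eq_C_mul, map_pow, map_mul, Fin.rev_rev]
    ring
  rw [Finset.sum_congr rfl fun l _ => key l, Finset.sum_add_distrib, Finset.sum_add_distrib,
    ← Finset.smul_sum, ← Finset.smul_sum, ← Finset.smul_sum, Finset.sum_add_distrib,
    hr fun l => S l l, hr fun l => S l l.rev, ← add_smul, h0, zero_smul, zero_add, ← two_smul ℂ,
    smul_smul, mul_comm _ (2 : ℂ), h1, one_smul]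

/-- Primality may be checked for the split form `∑ l, e_l ⊗ e_{rev l}`. -/
lemma relIdeal_id_isPrime (h : (relIdeal n k Fin.rev).IsPrime) :
    (relIdeal n k id).IsPrime := by
  let a : ℂ := (1 - Complex.I) / 2
  let b : ℂ := (1 + Complex.I) / 2
  have hI : Complex.I ^ 2 = -1 := Complex.I_sq
  have h0 : a ^ 2 + b ^ 2 = 0 := by
    simp only [a, b]
    linear_combination (1 / 2) * hI
  have h1 : 2 * (a * b) = 1 := by
    simp only [a, b]
    linear_combination (-1 / 2) * hI
  have hcomp : revComb n b a ∘ₗ revComb n a b = LinearMap.id := by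
    rw [revComb_comp, show b * a + a * b = 1 by linear_combination h1,
      show b * b + a * a = 0 by linear_combination h0]
    simp [revComb]
  have heq : relIdeal n k id =
      (relIdeal n k Fin.rev).comap (inducedHom (k + 1) (revComb n a b)) := by
    apply le_antisymm
    · rw [relIdeal, Ideal.span_le]
      rintro f (⟨u, w, rfl⟩ | ⟨u, w, rfl⟩)
      · rw [SetLike.mem_coe, Ideal.mem_comap, inducedHom_pluckerRel]
        exact pluckerRel_mem _ _ _
      · rw [SetLike.mem_coe, Ideal.mem_comap, inducedHom_orthRel_id h0 h1]
        exact orthRel_mem _ _ _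
    · intro f hf
      have hle : relIdeal n k Fin.rev ≤
          (relIdeal n k id).comap (inducedHom (k + 1) (revComb n b a)) := by
        rw [relIdeal, Ideal.span_le]
        rintro f (⟨u, w, rfl⟩ | ⟨u, w, rfl⟩)
        · rw [SetLike.mem_coe, Ideal.mem_comap, inducedHom_pluckerRel]
          exact pluckerRel_mem _ _ _
        · rw [SetLike.mem_coe, Ideal.mem_comap, inducedHom_orthRel_rev
            (by rw [add_comm]; exact h0) (by rw [mul_comm b]; exact h1)]
          exact orthRel_mem _ _ _
      have := hle (Ideal.mem_comap.mp hf)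
      rwa [Ideal.mem_comap, inducedHom_comp_apply hcomp] at this
  rw [heq]
  exact Ideal.comap_isPrime _ _

end ChangeOfCoordinates

section LieAction

variable {n k : ℕ}

/-- The Leibniz action of a linear endomorphism on an alternating map. -/
noncomputable def lieAlternating {N : Type*} [AddCommGroup N] [Module ℂ N]
    (X : (Fin n → ℂ) →ₗ[ℂ] (Fin n → ℂ)) (f : (Fin n → ℂ) [⋀^Fin k]→ₗ[ℂ] N) :
    (Fin n → ℂ) [⋀^Fin k]→ₗ[ℂ] N :=
  { ∑ a, f.toMultilinearMap.compLinearMap (fun b => if b = a then X else LinearMap.id) with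
    map_eq_zero_of_eq' := fun v i j hv hij => by
      have h : ∀ a, (f.toMultilinearMap.compLinearMap
          (fun b => if b = a then X else LinearMap.id)) v =
          f (Function.update v a (X (v a))) := fun a => by
        rw [MultilinearMap.compLinearMap_apply]
        refine congrArg f (funext fun b => ?_)
        by_cases hb : b = a
        · subst hb
          simp
        · simp [hb]
      change (∑ a, f.toMultilinearMap.compLinearMap
          (fun b => if b = a then X else LinearMap.id)) v = 0
      rw [sum_apply, Finset.sum_congr rfl fun a _ => h a,
        Finset.sum_eq_add i j hij]
      · have hswap : Function.update v j (X (v j)) =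
            Function.update v i (X (v i)) ∘ Equiv.swap i j := by
          funext b
          by_cases hbi : b = i
          · subst hbi
            simp [hij, hij.symm, hv]
          · by_cases hbj : b = j
            · subst hbj
              simp [hv]
            · simp [hbi, hbj, Equiv.swap_apply_of_ne_of_ne]
        rw [hswap, AlternatingMap.map_swap _ _ hij, add_neg_cancel]
      · rintro a - ⟨hai, haj⟩
        exact f.map_eq_zero_of_eq _ (by simp [hai.symm, haj.symm, hv]) hij
      · simp
      · simp }

lemma lieAlternating_apply {N : Type*} [AddCommGroup N] [Module ℂ N]
    (X : (Fin n → ℂ) →ₗ[ℂ] (Fin n → ℂ)) (f : (Fin n → ℂ) [⋀^Fin k]→ₗ[ℂ] N)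
    (v : Fin k → Fin n → ℂ) :
    lieAlternating X f v = ∑ a, f (Function.update v a (X (v a))) := by
  change (∑ a, f.toMultilinearMap.compLinearMap
    (fun b => if b = a then X else LinearMap.id)) v = _
  rw [sum_apply]
  refine Finset.sum_congr rfl fun a _ => ?_
  rw [MultilinearMap.compLinearMap_apply]
  refine congrArg f (funext fun b => ?_)
  by_cases hb : b = a
  · subst hb
    simp
  · simp [hb]

/-- The derivation of the Plücker ring induced by a linear endomorphism of `ℂⁿ`. -/
noncomputable def lieDer (k : ℕ) (X : (Fin n → ℂ) →ₗ[ℂ] (Fin n → ℂ)) :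
    Derivation ℂ (PlRing n k) (PlRing n k) :=
  MvPolynomial.mkDerivation ℂ fun K => lieAlternating X (plucker n k) (stdFam (enum K))

lemma lieDer_plucker (X : (Fin n → ℂ) →ₗ[ℂ] (Fin n → ℂ)) (v : Fin k → Fin n → ℂ) :
    lieDer k X (plucker n k v) = ∑ a, plucker n k (Function.update v a (X (v a))) := by
  rw [← lieAlternating_apply]
  have : (lieDer k X).toLinearMap.compAlternatingMap (plucker n k) =
      lieAlternating X (plucker n k) := by
    refine alternatingMap_ext_enum fun K => ?_
    simp [plucker_enum, lieDer, MvPolynomial.mkDerivation_X]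
  exact DFunLike.congr_fun this v

lemma plucker_update_comm_term (X Y : (Fin n → ℂ) →ₗ[ℂ] (Fin n → ℂ)) (v : Fin k → Fin n → ℂ)
    (a b : Fin k) :
    plucker n k (Function.update (Function.update v a (Y (v a))) b
        (X (Function.update v a (Y (v a)) b))) -
      plucker n k (Function.update (Function.update v b (X (v b))) a
        (Y (Function.update v b (X (v b)) a))) =
      if b = a then plucker n k (Function.update v a ((X ∘ₗ Y - Y ∘ₗ X) (v a))) else 0 := by
  split_ifs with h
  · subst h
    simp only [Function.update_self, Function.update_idem, LinearMap.sub_apply,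
      LinearMap.comp_apply, AlternatingMap.map_update_sub]
  · rw [Function.update_of_ne h, Function.update_of_ne (Ne.symm h), Function.update_comm h,
      sub_self]

lemma derivation_ext_plucker {D D' : Derivation ℂ (PlRing n k) (PlRing n k)}
    (h : ∀ v, D (plucker n k v) = D' (plucker n k v)) : D = D' :=
  MvPolynomial.derivation_ext fun K => by
    rw [← plucker_enum]
    exact h _

lemma lieDer_commutator (X Y : (Fin n → ℂ) →ₗ[ℂ] (Fin n → ℂ)) (f : PlRing n k) :
    lieDer k X (lieDer k Y f) - lieDer k Y (lieDer k X f) =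
      lieDer k (X ∘ₗ Y - Y ∘ₗ X) f := by
  have : ⁅lieDer k X, lieDer k Y⁆ = lieDer k (X ∘ₗ Y - Y ∘ₗ X) := by
    refine derivation_ext_plucker fun v => ?_
    rw [Derivation.commutator_apply]
    simp only [lieDer_plucker, map_sum]
    rw [Finset.sum_comm (f := fun a b => plucker n k (Function.update
      (Function.update v a (X (v a))) b (Y (Function.update v a (X (v a)) b)))),
      ← Finset.sum_sub_distrib]
    refine Finset.sum_congr rfl fun a _ => ?_
    rw [← Finset.sum_sub_distrib, Finset.sum_congr rfl fun b _ =>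
      plucker_update_comm_term X Y v a b]
    simp
  rw [← this, Derivation.commutator_apply]

lemma lieDer_sub (X Y : (Fin n → ℂ) →ₗ[ℂ] (Fin n → ℂ)) :
    lieDer k (X - Y) = lieDer k X - lieDer k Y := by
  refine derivation_ext_plucker fun v => ?_
  simp only [Derivation.sub_apply, lieDer_plucker, LinearMap.sub_apply,
    AlternatingMap.map_update_sub, Finset.sum_sub_distrib]

lemma lieDer_plucker_cons (X : (Fin n → ℂ) →ₗ[ℂ] (Fin n → ℂ)) (x : Fin n → ℂ)
    (u : Fin k → Fin n → ℂ) :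
    lieDer (k + 1) X (plucker n (k + 1) (vecCons x u)) =
      plucker n (k + 1) (vecCons (X x) u) +
        ∑ a, plucker n (k + 1) (vecCons x (Function.update u a (X (u a)))) := by
  rw [lieDer_plucker, Fin.sum_univ_succ]
  congr 1
  · congr 1
    exact Fin.update_cons_zero _ _ _
  · refine Finset.sum_congr rfl fun a _ => ?_
    congr 1
    exact (Fin.cons_update (α := fun _ => Fin n → ℂ) x u a (X (u a))).symm

lemma lieDer_plucker_removeNth (X : (Fin n → ℂ) →ₗ[ℂ] (Fin n → ℂ)) (j : Fin (k + 1))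
    (w : Fin (k + 1) → Fin n → ℂ) :
    lieDer k X (plucker n k (j.removeNth w)) =
      ∑ a, plucker n k
          (j.removeNth (Function.update w (j.succAbove a) (X (w (j.succAbove a))))) := by
  rw [lieDer_plucker]
  refine Finset.sum_congr rfl fun a _ => ?_
  rw [Fin.removeNth_update_succAbove]
  rfl

lemma lieDer_pluckerRel (X : (Fin n → ℂ) →ₗ[ℂ] (Fin n → ℂ)) (u : Fin k → Fin n → ℂ)
    (w : Fin (k + 2) → Fin n → ℂ) :
    lieDer (k + 1) X (pluckerRel u w) =
      ∑ a, pluckerRel (Function.update u a (X (u a))) w +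
        ∑ m, pluckerRel u (Function.update w m (X (w m))) := by
  have hsgn : ∀ (j : ℕ) (f : PlRing n (k + 1)),
      lieDer (k + 1) X ((-1) ^ j * f) = (-1) ^ j * lieDer (k + 1) X f := fun j f => by
    rcases Nat.even_or_odd j with h | h
    · simp [h.neg_one_pow]
    · simp [h.neg_one_pow]
  simp only [pluckerRel_apply, map_sum]
  refine Eq.trans ?_ (congrArg₂ HAdd.hAdd Finset.sum_comm Finset.sum_comm)
  rw [← Finset.sum_add_distrib]
  refine Finset.sum_congr rfl fun j _ => ?_
  rw [hsgn, Derivation.leibniz, lieDer_plucker_cons, lieDer_plucker_removeNth,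
    Fin.sum_univ_succAbove _ j, Fin.removeNth_update, Function.update_self]
  simp only [Function.update_of_ne (Fin.succAbove_ne j _).symm, ← Finset.mul_sum,
    ← Finset.sum_mul, smul_eq_mul]
  ring

lemma lieDer_orthRel (τ : Fin n → Fin n) (X : (Fin n → ℂ) →ₗ[ℂ] (Fin n → ℂ))
    (hX : ∀ u w : Fin k → Fin n → ℂ,
      ∑ l, (plucker n (k + 1) (vecCons (X (stdVec l)) u) *
          plucker n (k + 1) (vecCons (stdVec (τ l)) w) +
        plucker n (k + 1) (vecCons (stdVec l) u) *
          plucker n (k + 1) (vecCons (X (stdVec (τ l))) w)) = 0)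
    (u w : Fin k → Fin n → ℂ) :
    lieDer (k + 1) X (orthRel τ u w) =
      ∑ a, orthRel τ (Function.update u a (X (u a))) w +
        ∑ a, orthRel τ u (Function.update w a (X (w a))) := by
  simp only [orthRel, map_sum]
  refine Eq.trans ?_ (add_zero _)
  refine Eq.trans ?_ (congrArg₂ HAdd.hAdd
    (congrArg₂ HAdd.hAdd Finset.sum_comm Finset.sum_comm) (hX u w))
  rw [← Finset.sum_add_distrib, ← Finset.sum_add_distrib]
  refine Finset.sum_congr rfl fun l _ => ?_
  rw [Derivation.leibniz, lieDer_plucker_cons, lieDer_plucker_cons]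
  simp only [← Finset.mul_sum, ← Finset.sum_mul, smul_eq_mul]
  ring

/-- An ideal is stable under a derivation as soon as its generators are mapped into it. -/
lemma derivation_mem_of_span {R : Type*} [CommRing R] [Algebra ℂ R] (D : Derivation ℂ R R)
    (S : Set R) (h : ∀ s ∈ S, D s ∈ Ideal.span S) {f : R} (hf : f ∈ Ideal.span S) :
    D f ∈ Ideal.span S := by
  induction hf using Submodule.span_induction with
  | mem x hx => exact h x hx
  | zero => simp
  | add x y _ _ hx hy => simpa using add_mem hx hy
  | smul a x hx ih =>
    rw [smul_eq_mul, Derivation.leibniz]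
    exact add_mem (Ideal.mul_mem_left _ _ ih) (by
      rw [smul_eq_mul]
      exact Ideal.mul_mem_right _ _ hx)

end LieAction

section Skew

variable {n k : ℕ}

/-- The elementary endomorphism `e_j ↦ e_i`. -/
noncomputable def elem (i j : Fin n) : (Fin n → ℂ) →ₗ[ℂ] (Fin n → ℂ) :=
  (LinearMap.proj j).smulRight (stdVec i)

lemma elem_apply (i j : Fin n) (v : Fin n → ℂ) : elem i j v = v j • stdVec i := rfl

lemma elem_stdVec (i j l : Fin n) : elem i j (stdVec l) = if l = j then stdVec i else 0 := by
  rw [elem_apply]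
  split_ifs with h
  · simp [h]
  · simp [Ne.symm h]

/-- The elementary skew endomorphism for the split form. -/
noncomputable def skew (i j : Fin n) : (Fin n → ℂ) →ₗ[ℂ] (Fin n → ℂ) :=
  elem i j - elem j.rev i.rev

lemma lieDer_skew_mem (i j : Fin n) {f : PlRing n (k + 1)} (hf : f ∈ relIdeal n k Fin.rev) :
    lieDer (k + 1) (skew i j) f ∈ relIdeal n k Fin.rev := by
  refine derivation_mem_of_span _ _ ?_ hf
  rintro f (⟨u, w, rfl⟩ | ⟨u, w, rfl⟩)
  · rw [lieDer_pluckerRel]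
    exact add_mem (sum_mem fun a _ => pluckerRel_mem _ _ _)
      (sum_mem fun a _ => pluckerRel_mem _ _ _)
  · rw [lieDer_orthRel]
    · exact add_mem (sum_mem fun a _ => orthRel_mem _ _ _) (sum_mem fun a _ => orthRel_mem _ _ _)
    · intro u w
      have hx : ∀ (P : Prop) [Decidable P] (x : Fin n → ℂ) (u : Fin k → Fin n → ℂ),
          plucker n (k + 1) (vecCons (if P then x else 0) u) =
            if P then plucker n (k + 1) (vecCons x u) else 0 := fun P _ x u => by
        split_ifs
        · rfl
        · exact AlternatingMap.map_coord_zero _ 0 rfl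
      have hsub : ∀ (x y : Fin n → ℂ) (u : Fin k → Fin n → ℂ),
          plucker n (k + 1) (vecCons (x - y) u) =
            plucker n (k + 1) (vecCons x u) - plucker n (k + 1) (vecCons y u) := fun x y u => by
        rw [sub_eq_add_neg, ← neg_one_smul ℂ y, AlternatingMap.map_vecCons_add,
          AlternatingMap.map_vecCons_smul, neg_one_smul, sub_eq_add_neg]
      simp only [skew, LinearMap.sub_apply, elem_stdVec, hsub, hx, sub_mul, mul_sub, ite_mul,
        mul_ite, zero_mul, mul_zero, Finset.sum_add_distrib, Finset.sum_sub_distrib,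
        Fin.rev_eq_iff, Finset.sum_ite_eq', Finset.mem_univ, if_true, Fin.rev_rev]
      ring

end Skew

section Casimir

variable {n k : ℕ}

lemma stdFam_update (g : Fin k → Fin n) (a : Fin k) (i : Fin n) :
    Function.update (stdFam g) a (stdVec i) = stdFam (Function.update g a i) := by
  funext b
  by_cases hb : b = a
  · subst hb
    simp [stdFam]
  · simp [stdFam, hb]

lemma lieDer_elem_stdFam (i j : Fin n) (g : Fin k → Fin n) :
    lieDer k (elem i j) (plucker n k (stdFam g)) =
      ∑ a, if g a = j then plucker n k (stdFam (Function.update g a i)) else 0 := by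
  rw [lieDer_plucker]
  refine Finset.sum_congr rfl fun a _ => ?_
  rw [elem_stdVec]
  split_ifs with h
  · rw [stdFam_update]
  · exact AlternatingMap.map_coord_zero _ a (by simp)

lemma plucker_stdFam_swap (g h : Fin k → Fin n) {a b : Fin k} (hab : a ≠ b)
    (hg : g = h ∘ Equiv.swap a b) :
    plucker n k (stdFam g) = -plucker n k (stdFam h) := by
  rw [hg, ← AlternatingMap.map_swap _ _ hab]
  rfl

/-- The Euler derivation. -/
noncomputable def euler (n k : ℕ) : Derivation ℂ (PlRing n k) (PlRing n k) :=
  MvPolynomial.mkDerivation ℂ MvPolynomial.X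

lemma euler_X (K : {K : Finset (Fin n) // K.card = k}) :
    euler n k (MvPolynomial.X K) = MvPolynomial.X K :=
  MvPolynomial.mkDerivation_X _ _ _

lemma euler_plucker (v : Fin k → Fin n → ℂ) : euler n k (plucker n k v) = plucker n k v := by
  have : (euler n k).toLinearMap.compAlternatingMap (plucker n k) = plucker n k :=
    alternatingMap_ext_enum fun K => by
      simp [plucker_enum, euler_X]
  exact DFunLike.congr_fun this v

lemma euler_mem (τ : Fin n → Fin n) {f : PlRing n (k + 1)} (hf : f ∈ relIdeal n k τ) :
    euler n (k + 1) f ∈ relIdeal n k τ := by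
  refine derivation_mem_of_span _ _ ?_ hf
  rintro f (⟨u, w, rfl⟩ | ⟨u, w, rfl⟩)
  · have : euler n (k + 1) (pluckerRel u w) = 2 * pluckerRel u w := by
      rw [pluckerRel_apply, map_sum, Finset.mul_sum]
      refine Finset.sum_congr rfl fun j _ => ?_
      rcases Nat.even_or_odd (j : ℕ) with h | h
      · simp [h.neg_one_pow, euler_plucker]
        ring
      · simp [h.neg_one_pow, euler_plucker]
        ring
    rw [this]
    exact Ideal.mul_mem_left _ _ (pluckerRel_mem τ u w)
  · have : euler n (k + 1) (orthRel τ u w) = 2 * orthRel τ u w := by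
      rw [orthRel, map_sum, Finset.mul_sum]
      refine Finset.sum_congr rfl fun j _ => ?_
      simp [euler_plucker]
      ring
    rw [this]
    exact Ideal.mul_mem_left _ _ (orthRel_mem τ u w)

/-- A derivation mapping the variables into an ideal maps everything into it. -/
lemma derivation_mem_of_X {σ : Type*} (D : Derivation ℂ (MvPolynomial σ ℂ) (MvPolynomial σ ℂ))
    (I : Ideal (MvPolynomial σ ℂ)) (h : ∀ i, D (MvPolynomial.X i) ∈ I) (f : MvPolynomial σ ℂ) :
    D f ∈ I := by
  induction f using MvPolynomial.induction_on with
  | C a =>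
    rw [← MvPolynomial.algebraMap_eq, Derivation.map_algebraMap]
    exact zero_mem _
  | add p q hp hq => simpa using add_mem hp hq
  | mul_X p i hp =>
    rw [Derivation.leibniz, smul_eq_mul, smul_eq_mul]
    exact add_mem (Ideal.mul_mem_left _ _ (h i)) (Ideal.mul_mem_left _ _ hp)

lemma sum_skew_pairs {A : Type*} [AddCommGroup A] (F : Fin n → Fin n → Fin n → Fin n → A) :
    ∑ i, ∑ j, (F i j j i - F i j i.rev j.rev - F j.rev i.rev j i + F j.rev i.rev i.rev j.rev) =
      2 • (∑ i, ∑ j, F i j j i - ∑ i, ∑ j, F i j i.rev j.rev) := by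
  have e : ∀ G : Fin n → Fin n → A, ∑ i : Fin n, ∑ j : Fin n, G j.rev i.rev =
      ∑ i, ∑ j, G i j := fun G => by
    rw [Finset.sum_comm, ← Equiv.sum_comp Fin.revPerm (fun i => ∑ j, G i j)]
    refine Finset.sum_congr rfl fun j _ => ?_
    exact Equiv.sum_comp Fin.revPerm fun i => G j.rev i
  have e1 := e fun i j => F i j i.rev j.rev
  have e2 := e fun i j => F i j j i
  simp only [Fin.rev_rev] at e1 e2
  simp only [Finset.sum_add_distrib, Finset.sum_sub_distrib]
  rw [e1, e2]
  abel

lemma sum_lieDer_elem_mul (g h : Fin k → Fin n) :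
    ∑ i, ∑ j, lieDer k (elem i j) (plucker n k (stdFam g)) *
        lieDer k (elem j i) (plucker n k (stdFam h)) =
      ∑ a, ∑ b, plucker n k (stdFam (Function.update g a (h b))) *
        plucker n k (stdFam (Function.update h b (g a))) := by
  have : ∀ i j : Fin n, lieDer k (elem i j) (plucker n k (stdFam g)) *
        lieDer k (elem j i) (plucker n k (stdFam h)) = ∑ a, ∑ b,
      if g a = j then if h b = i then plucker n k (stdFam (Function.update g a i)) *
        plucker n k (stdFam (Function.update h b j)) else 0 else 0 := fun i j => by
    rw [lieDer_elem_stdFam, lieDer_elem_stdFam, Finset.sum_mul_sum]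
    refine Finset.sum_congr rfl fun a _ => Finset.sum_congr rfl fun b _ => ?_
    split_ifs <;> simp
  simp only [this]
  rw [Finset.sum_congr rfl fun i _ => Finset.sum_comm, Finset.sum_comm]
  refine Finset.sum_congr rfl fun a _ => ?_
  rw [Finset.sum_congr rfl fun i _ => Finset.sum_comm, Finset.sum_comm]
  refine Finset.sum_congr rfl fun b _ => ?_
  simp

lemma sum_lieDer_elem_rev_mul (g h : Fin k → Fin n) :
    ∑ i, ∑ j, lieDer k (elem i j) (plucker n k (stdFam g)) *
        lieDer k (elem i.rev j.rev) (plucker n k (stdFam h)) =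
      ∑ a, ∑ b, if h b = (g a).rev then ∑ i, plucker n k (stdFam (Function.update g a i)) *
        plucker n k (stdFam (Function.update h b i.rev)) else 0 := by
  have : ∀ i j : Fin n, lieDer k (elem i j) (plucker n k (stdFam g)) *
        lieDer k (elem i.rev j.rev) (plucker n k (stdFam h)) = ∑ a, ∑ b,
      if g a = j then if h b = j.rev then plucker n k (stdFam (Function.update g a i)) *
        plucker n k (stdFam (Function.update h b i.rev)) else 0 else 0 := fun i j => by
    rw [lieDer_elem_stdFam, lieDer_elem_stdFam, Finset.sum_mul_sum]
    refine Finset.sum_congr rfl fun a _ => Finset.sum_congr rfl fun b _ => ?_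
    split_ifs <;> simp
  simp only [this]
  rw [Finset.sum_congr rfl fun i _ => Finset.sum_comm, Finset.sum_comm]
  refine Finset.sum_congr rfl fun a _ => ?_
  rw [Finset.sum_congr rfl fun i _ => Finset.sum_comm, Finset.sum_comm]
  refine Finset.sum_congr rfl fun b _ => ?_
  simp only [Finset.sum_ite_eq, Finset.mem_univ, if_true]
  split_ifs <;> simp

lemma orthRel_update_mem (g h : Fin (k + 1) → Fin n) (a b : Fin (k + 1)) :
    ∑ i, plucker n (k + 1) (stdFam (Function.update g a i)) *
      plucker n (k + 1) (stdFam (Function.update h b i.rev)) ∈ relIdeal n k Fin.rev := by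
  have key : orthRel Fin.rev (a.removeNth (stdFam g)) (b.removeNth (stdFam h)) =
      (-1) ^ ((a : ℕ) + b) * ∑ i, plucker n (k + 1) (stdFam (Function.update g a i)) *
        plucker n (k + 1) (stdFam (Function.update h b i.rev)) := by
    rw [orthRel, Finset.mul_sum]
    refine Finset.sum_congr rfl fun i _ => ?_
    rw [plucker_cons_removeNth, plucker_cons_removeNth, stdFam_update, stdFam_update]
    ring
  have h := orthRel_mem Fin.rev (a.removeNth (stdFam g)) (b.removeNth (stdFam h))
  rw [key] at h
  exact (Ideal.unit_mul_mem_iff_mem _ ((isUnit_one.neg).pow _)).1 h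

lemma lieDer_skew (i j : Fin n) (f : PlRing n k) :
    lieDer k (skew i j) f = lieDer k (elem i j) f - lieDer k (elem j.rev i.rev) f := by
  rw [skew, lieDer_sub, Derivation.sub_apply]

lemma sum_lieDer_skew_mul (f g : PlRing n k) :
    ∑ i, ∑ j, lieDer k (skew i j) f * lieDer k (skew j i) g =
      2 * (∑ i, ∑ j, lieDer k (elem i j) f * lieDer k (elem j i) g -
        ∑ i, ∑ j, lieDer k (elem i j) f * lieDer k (elem i.rev j.rev) g) := by
  have := sum_skew_pairs fun i j p q : Fin n => lieDer k (elem i j) f * lieDer k (elem p q) g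
  rw [two_nsmul, ← two_mul] at this
  rw [← this]
  refine Finset.sum_congr rfl fun i _ => Finset.sum_congr rfl fun j _ => ?_
  rw [lieDer_skew, lieDer_skew]
  ring

lemma sum_lieDer_skew_skew (f : PlRing n k) :
    ∑ i, ∑ j, lieDer k (skew i j) (lieDer k (skew j i) f) =
      2 * (∑ i, ∑ j, lieDer k (elem i j) (lieDer k (elem j i) f) -
        ∑ i, ∑ j, lieDer k (elem i j) (lieDer k (elem i.rev j.rev) f)) := by
  have := sum_skew_pairs fun i j p q : Fin n => lieDer k (elem i j) (lieDer k (elem p q) f)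
  rw [two_nsmul, ← two_mul] at this
  rw [← this]
  refine Finset.sum_congr rfl fun i _ => Finset.sum_congr rfl fun j _ => ?_
  rw [lieDer_skew, lieDer_skew, map_sub, map_sub]
  ring

lemma sum_lieDer_skew_mul_plucker_mem (g h : Fin (k + 1) → Fin n) :
    ∑ i, ∑ j, lieDer (k + 1) (skew i j) (plucker n (k + 1) (stdFam g)) *
        lieDer (k + 1) (skew j i) (plucker n (k + 1) (stdFam h)) -
      2 * (k + 1) * (plucker n (k + 1) (stdFam g) * plucker n (k + 1) (stdFam h)) ∈
        relIdeal n k Fin.rev := by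
  rw [sum_lieDer_skew_mul, sum_lieDer_elem_mul, sum_lieDer_elem_rev_mul, mul_assoc, ← mul_sub,
    sub_right_comm]
  refine Ideal.mul_mem_left _ _ (sub_mem ?_ (sum_mem fun a _ => sum_mem fun b _ => ?_))
  · have := sum_mem (S := relIdeal n k Fin.rev) (t := Finset.univ) fun a _ =>
      exchange_mem Fin.rev (stdFam g) (stdFam h) a
    simpa only [stdFam_update, Finset.sum_sub_distrib, Finset.sum_const, Finset.card_univ,
      Fintype.card_fin, nsmul_eq_mul, Nat.cast_add, Nat.cast_one] using this
  · split_ifs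
    · exact orthRel_update_mem g h a b
    · exact zero_mem _

lemma derivation_sum_apply {ι R : Type*} [CommRing R] [Algebra ℂ R] (s : Finset ι)
    (D : ι → Derivation ℂ R R) (f : R) : (∑ i ∈ s, D i) f = ∑ i ∈ s, D i f :=
  (congrFun (map_sum Derivation.coeFnAddMonoidHom D s) f).trans (Finset.sum_apply _ _ _)

lemma sum_lieDer_skew_mul_X_mem (f : PlRing n (k + 1))
    (K : {K : Finset (Fin n) // K.card = k + 1}) :
    ∑ i, ∑ j, lieDer (k + 1) (skew i j) f * lieDer (k + 1) (skew j i) (MvPolynomial.X K) -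
      2 * (k + 1) * (euler n (k + 1) f * (MvPolynomial.X K : PlRing n (k + 1))) ∈
        relIdeal n k Fin.rev := by
  let D : Derivation ℂ (PlRing n (k + 1)) (PlRing n (k + 1)) :=
    ∑ i, ∑ j, lieDer (k + 1) (skew j i) (MvPolynomial.X K) • lieDer (k + 1) (skew i j) -
      (2 * (k + 1) * (MvPolynomial.X K : PlRing n (k + 1))) • euler n (k + 1)
  have hD : ∀ f, D f = ∑ i, ∑ j, lieDer (k + 1) (skew i j) f *
      lieDer (k + 1) (skew j i) (MvPolynomial.X K) -
      2 * (k + 1) * (euler n (k + 1) f * (MvPolynomial.X K : PlRing n (k + 1))) := fun f => by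
    simp only [D, Derivation.sub_apply, derivation_sum_apply,
      Derivation.smul_apply, smul_eq_mul, mul_comm (lieDer (k + 1) (skew _ _) f)]
    ring
  rw [← hD]
  refine derivation_mem_of_X D _ (fun L => ?_) f
  rw [hD, euler_X, ← plucker_enum, ← plucker_enum]
  exact sum_lieDer_skew_mul_plucker_mem _ _

lemma update_update_comp_swap (g : Fin k → Fin n) {a b : Fin k} (hab : a ≠ b) (i j : Fin n) :
    Function.update (Function.update g a i) b j =
      Function.update (Function.update g a j) b i ∘ Equiv.swap a b := by
  funext c
  by_cases hca : c = a
  · subst hca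
    simp [hab]
  · by_cases hcb : c = b
    · subst hcb
      simp [hab]
    · simp [hca, hcb, Equiv.swap_apply_of_ne_of_ne]

lemma sum_lieDer_elem_elem (g : Fin (k + 1) → Fin n) :
    ∑ i, ∑ j, lieDer (k + 1) (elem i j) (lieDer (k + 1) (elem j i)
        (plucker n (k + 1) (stdFam g))) =
      (k + 1) * (n - k) * plucker n (k + 1) (stdFam g) := by
  have h1 : ∀ i j : Fin n, lieDer (k + 1) (elem i j) (lieDer (k + 1) (elem j i)
        (plucker n (k + 1) (stdFam g))) = ∑ a, ∑ b, if g a = i then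
          if Function.update g a j b = j then plucker n (k + 1) (stdFam
            (Function.update (Function.update g a j) b i)) else 0 else 0 := fun i j => by
    rw [lieDer_elem_stdFam, map_sum]
    refine Finset.sum_congr rfl fun a _ => ?_
    split_ifs
    · rw [lieDer_elem_stdFam]
    · simp
  have h2 : ∀ a b : Fin (k + 1), (∑ i, ∑ j, if g a = i then
          if Function.update g a j b = j then plucker n (k + 1) (stdFam
            (Function.update (Function.update g a j) b i)) else 0 else 0) =
      (if b = a then (n + 1 : PlRing n (k + 1)) * plucker n (k + 1) (stdFam g) else 0) -
        plucker n (k + 1) (stdFam g) := fun a b => by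
    by_cases hb : b = a
    · subst hb
      simp
      ring
    · rw [Finset.sum_comm]
      simp only [Function.update_of_ne hb, Finset.sum_ite_eq, Finset.mem_univ, if_true, if_neg hb]
      rw [update_update_comp_swap g (Ne.symm hb),
        plucker_stdFam_swap _ _ (Ne.symm hb) rfl]
      simp
  simp only [h1]
  rw [Finset.sum_congr rfl fun i _ => Finset.sum_comm, Finset.sum_comm]
  rw [Finset.sum_congr rfl fun a _ => (Finset.sum_congr rfl fun i _ => Finset.sum_comm).trans
    Finset.sum_comm]
  simp only [h2, Finset.sum_sub_distrib]
  simp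
  ring

lemma sum_plucker_update_update_rev (g : Fin k → Fin n) {a b : Fin k} (hab : a ≠ b) :
    ∑ i : Fin n, plucker n k (stdFam (Function.update (Function.update g a i.rev) b i)) = 0 := by
  have : ∑ i : Fin n, plucker n k (stdFam (Function.update (Function.update g a i.rev) b i)) =
      -∑ i : Fin n, plucker n k (stdFam (Function.update (Function.update g a i.rev) b i)) := by
    rw [← Finset.sum_neg_distrib, ← Equiv.sum_comp Fin.revPerm]
    refine Finset.sum_congr rfl fun i _ => ?_
    rw [plucker_stdFam_swap _ _ hab (update_update_comp_swap g hab _ _)]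
    simp
  exact self_eq_neg.1 this

lemma sum_lieDer_elem_rev_elem (g : Fin (k + 1) → Fin n) :
    ∑ i, ∑ j, lieDer (k + 1) (elem i j) (lieDer (k + 1) (elem i.rev j.rev)
        (plucker n (k + 1) (stdFam g))) =
      (k + 1) * plucker n (k + 1) (stdFam g) := by
  have h1 : ∀ i j : Fin n, lieDer (k + 1) (elem i j) (lieDer (k + 1) (elem i.rev j.rev)
        (plucker n (k + 1) (stdFam g))) = ∑ a, ∑ b, if j = (g a).rev then
          if Function.update g a i.rev b = j then plucker n (k + 1) (stdFam
            (Function.update (Function.update g a i.rev) b i)) else 0 else 0 := fun i j => by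
    rw [lieDer_elem_stdFam, map_sum]
    refine Finset.sum_congr rfl fun a _ => ?_
    simp only [eq_comm (a := g a), Fin.rev_eq_iff]
    split_ifs
    · rw [lieDer_elem_stdFam]
    · simp
  have h2 : ∀ a b : Fin (k + 1), (∑ i, ∑ j, if j = (g a).rev then
          if Function.update g a i.rev b = j then plucker n (k + 1) (stdFam
            (Function.update (Function.update g a i.rev) b i)) else 0 else 0) =
      if b = a then plucker n (k + 1) (stdFam g) else 0 := fun a b => by
    by_cases hb : b = a
    · subst hb
      simp
    · simp only [Function.update_of_ne hb, Finset.sum_ite_eq', Finset.mem_univ, if_true, if_neg hb]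
      by_cases hg : g b = (g a).rev
      · simp only [hg, if_true]
        exact sum_plucker_update_update_rev g (Ne.symm hb)
      · simp [hg]
  simp only [h1]
  rw [Finset.sum_congr rfl fun i _ => Finset.sum_comm, Finset.sum_comm]
  rw [Finset.sum_congr rfl fun a _ => (Finset.sum_congr rfl fun i _ => Finset.sum_comm).trans
    Finset.sum_comm]
  simp only [h2]
  simp

/-- The Casimir operator acts, modulo the relations, as a polynomial in the Euler derivation. -/
lemma casimir_sub_euler_mem (f : PlRing n (k + 1)) :
    ∑ i, ∑ j, lieDer (k + 1) (skew i j) (lieDer (k + 1) (skew j i) f) -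
      (2 * (k + 1) * euler n (k + 1) (euler n (k + 1) f) +
        2 * (k + 1) * (n - k - 2) * euler n (k + 1) f) ∈ relIdeal n k Fin.rev := by
  induction f using MvPolynomial.induction_on with
  | C a =>
    simp only [← MvPolynomial.algebraMap_eq, Derivation.map_algebraMap, map_zero]
    simp
  | add p q hp hq =>
    simp only [map_add, Finset.sum_add_distrib]
    convert add_mem hp hq using 1
    ring
  | mul_X p K hp =>
    have hX : ∑ i, ∑ j, lieDer (k + 1) (skew i j) (lieDer (k + 1) (skew j i)
        (MvPolynomial.X K : PlRing n (k + 1))) = 2 * (k + 1) * (n - k - 1) *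
          (MvPolynomial.X K : PlRing n (k + 1)) := by
      rw [sum_lieDer_skew_skew, ← plucker_enum, sum_lieDer_elem_elem, sum_lieDer_elem_rev_elem]
      ring
    have hpX := sum_lieDer_skew_mul_X_mem p K
    have hC : ∑ i, ∑ j, lieDer (k + 1) (skew i j) (lieDer (k + 1) (skew j i)
        (p * MvPolynomial.X K)) =
          (∑ i, ∑ j, lieDer (k + 1) (skew i j) (lieDer (k + 1) (skew j i) p)) *
              MvPolynomial.X K +
            p * ∑ i, ∑ j, lieDer (k + 1) (skew i j) (lieDer (k + 1) (skew j i)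
              (MvPolynomial.X K)) +
            2 * ∑ i, ∑ j, lieDer (k + 1) (skew i j) p *
              lieDer (k + 1) (skew j i) (MvPolynomial.X K) := by
      rw [two_mul]
      nth_rw 4 [Finset.sum_comm]
      simp only [Finset.sum_mul, Finset.mul_sum, ← Finset.sum_add_distrib]
      refine Finset.sum_congr rfl fun i _ => Finset.sum_congr rfl fun j _ => ?_
      simp only [Derivation.leibniz, map_add, smul_eq_mul]
      ring
    rw [hC, hX]
    simp only [Derivation.leibniz, map_add, smul_eq_mul, euler_X]
    convert add_mem (Ideal.mul_mem_right (MvPolynomial.X K) _ hp)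
      (Ideal.mul_mem_left _ 2 hpX) using 1
    ring

end Casimir

section MinimalPrimes

lemma exists_pow_mul_mem_of_mem_minimalPrimes {R : Type*} [CommRing R] {I P : Ideal R}
    (hP : P ∈ I.minimalPrimes) {f : R} (hf : f ∈ P) : ∃ (N : ℕ) (s : R), s ∉ P ∧ f ^ N * s ∈ I := by
  have := hP.1.1
  by_contra! h
  have hdis : Disjoint (I : Set R) (Submonoid.powers f ⊔ P.primeCompl : Submonoid R) := by
    rw [Set.disjoint_left]
    rintro x hxI hx
    obtain ⟨_, ⟨N, rfl⟩, s, hs, rfl⟩ := Submonoid.mem_sup.1 hx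
    exact h N s hs hxI
  obtain ⟨Q, hQ, hIQ, hQdis⟩ := Ideal.exists_le_prime_disjoint I _ hdis
  have hQP : Q ≤ P := fun x hx => by
    by_contra hxP
    exact Set.disjoint_left.1 hQdis hx
      ((le_sup_right : P.primeCompl ≤ Submonoid.powers f ⊔ P.primeCompl) hxP)
  exact Set.disjoint_left.1 hQdis (hP.2 ⟨hQ, hIQ⟩ hQP hf)
    ((le_sup_left : Submonoid.powers f ≤ Submonoid.powers f ⊔ P.primeCompl)
      (Submonoid.mem_powers f))

/-- Minimal primes over an ideal stable under a derivation are stable under this derivation. -/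
lemma derivation_mem_of_mem_minimalPrimes {R : Type*} [CommRing R] [Algebra ℂ R]
    {I P : Ideal R} (hP : P ∈ I.minimalPrimes) (D : Derivation ℂ R R)
    (hD : ∀ f ∈ I, D f ∈ I) {f : R} (hf : f ∈ P) : D f ∈ P := by
  classical
  have := hP.1.1
  by_contra hDf
  have hex := exists_pow_mul_mem_of_mem_minimalPrimes hP hf
  obtain ⟨s, hs, hfs⟩ := Nat.find_spec hex
  rcases hN : Nat.find hex with - | N
  · rw [hN, pow_zero, one_mul] at hfs
    exact hs (hP.1.2 hfs)
  · refine Nat.find_min hex (m := N) (by omega) ⟨D f * s ^ 2, fun h => ?_, ?_⟩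
    · rcases ‹P.IsPrime›.mem_or_mem h with h | h
      · exact hDf h
      · exact hs (‹P.IsPrime›.mem_of_pow_mem _ h)
    · rw [hN] at hfs
      have h1 := sub_mem (Ideal.mul_mem_left _ s (hD _ hfs)) (Ideal.mul_mem_left _ (D s) hfs)
      have h2 : s * D (f ^ (N + 1) * s) - D s * (f ^ (N + 1) * s) =
          algebraMap ℂ R (N + 1) * (f ^ N * (D f * s ^ 2)) := by
        simp only [Derivation.leibniz, Derivation.leibniz_pow, smul_eq_mul, nsmul_eq_mul,
          map_add, map_natCast, map_one, Nat.add_sub_cancel]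
        push_cast
        ring
      rw [h2] at h1
      exact (Ideal.unit_mul_mem_iff_mem _
        ((IsUnit.mk0 _ (Nat.cast_add_one_ne_zero N)).map (algebraMap ℂ R))).1 h1

end MinimalPrimes

section Weights

variable {n k : ℕ}

/-- The weight of a Plücker variable is the sum of its indices. -/
def idxWeight (K : {K : Finset (Fin n) // K.card = k}) : ℕ := ∑ i ∈ K.1, (i : ℕ)

/-- The polynomials all of whose monomials have weight less than `r`. -/
noncomputable def weightLT (n k r : ℕ) : Submodule ℂ (PlRing n k) :=
  MvPolynomial.restrictSupport ℂ {s | Finsupp.weight idxWeight s < r}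

lemma monomial_mem_weightLT {r : ℕ} {s : {K : Finset (Fin n) // K.card = k} →₀ ℕ} (c : ℂ)
    (h : Finsupp.weight idxWeight s < r) : MvPolynomial.monomial s c ∈ weightLT n k r :=
  (MvPolynomial.monomial_mem_restrictSupport ℂ).2 (Or.inl h)

lemma exists_mem_weightLT (f : PlRing n k) : ∃ r, f ∈ weightLT n k r := by
  refine ⟨f.support.sup (Finsupp.weight idxWeight) + 1, fun s hs => ?_⟩
  exact Nat.lt_succ_of_le (Finset.le_sup (f := Finsupp.weight idxWeight) hs)

lemma map_mem_weightLT {r r' : ℕ} (D : PlRing n k →ₗ[ℂ] PlRing n k)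
    (h : ∀ (s : {K : Finset (Fin n) // K.card = k} →₀ ℕ) (c : ℂ),
      Finsupp.weight idxWeight s < r → D (MvPolynomial.monomial s c) ∈ weightLT n k r')
    {f : PlRing n k} (hf : f ∈ weightLT n k r) : D f ∈ weightLT n k r' := by
  rw [f.as_sum, map_sum]
  exact sum_mem fun s hs => h s _ (hf hs)

lemma monomial_mul_mem_weightLT {r : ℕ} (t : {K : Finset (Fin n) // K.card = k} →₀ ℕ) (c : ℂ)
    {f : PlRing n k} (hf : f ∈ weightLT n k r) :
    MvPolynomial.monomial t c * f ∈ weightLT n k (Finsupp.weight idxWeight t + r) :=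
  map_mem_weightLT (LinearMap.mulLeft ℂ (MvPolynomial.monomial t c)) (fun s c' hs => by
    rw [LinearMap.mulLeft_apply, MvPolynomial.monomial_mul]
    refine monomial_mem_weightLT _ ?_
    rw [map_add]
    omega) hf

lemma derivation_mem_weightLT (D : Derivation ℂ (PlRing n k) (PlRing n k))
    (hD : ∀ K, D (MvPolynomial.X K) ∈ weightLT n k (idxWeight K)) {r : ℕ} {f : PlRing n k}
    (hf : f ∈ weightLT n k (r + 1)) : D f ∈ weightLT n k r := by
  refine map_mem_weightLT D.toLinearMap (fun s c hs => ?_) hf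
  have : D = MvPolynomial.mkDerivation ℂ fun K => D (MvPolynomial.X K) :=
    MvPolynomial.derivation_ext fun K => by rw [MvPolynomial.mkDerivation_X]
  rw [Derivation.coeFn_coe, this, MvPolynomial.mkDerivation_monomial]
  refine Submodule.smul_mem _ _ (sum_mem fun K hK => ?_)
  have h1 := monomial_mul_mem_weightLT (s - Finsupp.single K 1) (s K : ℂ) (hD K)
  have h2 : Finsupp.weight idxWeight (s - Finsupp.single K 1) + idxWeight K =
      Finsupp.weight idxWeight s := by
    have hs : s - Finsupp.single K 1 + Finsupp.single K 1 = s :=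
      tsub_add_cancel_of_le (by
        rw [Finsupp.single_le_iff]
        exact Nat.one_le_iff_ne_zero.2 (Finsupp.mem_support_iff.1 hK))
    conv_rhs => rw [← hs, map_add, Finsupp.weight_single, one_smul]
  rw [h2] at h1
  exact MvPolynomial.restrictSupport_mono ℂ
    (fun t (ht : Finsupp.weight idxWeight t < _) => lt_of_lt_of_le ht (Nat.lt_succ_iff.1 hs)) h1

lemma plucker_stdFam_mem_weightLT (g : Fin k → Fin n) {r : ℕ} (h : ∑ a, (g a : ℕ) < r) :
    plucker n k (stdFam g) ∈ weightLT n k r := by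
  rcases plucker_stdFam g with h0 | ⟨K, ε, hg, hK, h1⟩
  · rw [h0]
    exact zero_mem _
  · have : (MvPolynomial.X K : PlRing n k) ∈ weightLT n k r := by
      refine monomial_mem_weightLT _ ?_
      rw [Finsupp.weight_single, one_smul, idxWeight, hK,
        Finset.sum_image fun a _ b _ hab => hg hab]
      exact h
    rw [h1]
    rcases Int.units_eq_one_or ε with rfl | rfl
    · simpa using this
    · simpa using this

lemma sum_enum (K : {K : Finset (Fin n) // K.card = k}) : ∑ a, (enum K a : ℕ) = idxWeight K := by
  rw [idxWeight, ← Finset.sum_image fun a _ b _ hab => enum_injective K hab]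
  rw [Finset.image_orderEmbOfFin_univ]

lemma lieDer_elem_X_mem_weightLT {i j : Fin n} (hij : i < j)
    (K : {K : Finset (Fin n) // K.card = k}) :
    lieDer k (elem i j) (MvPolynomial.X K) ∈ weightLT n k (idxWeight K) := by
  rw [← plucker_enum, lieDer_elem_stdFam]
  refine sum_mem fun a _ => ?_
  split_ifs with h
  · refine plucker_stdFam_mem_weightLT _ ?_
    rw [← sum_enum]
    refine Finset.sum_lt_sum (fun b _ => ?_) ⟨a, Finset.mem_univ _, ?_⟩
    · by_cases hb : b = a
      · subst hb
        simpa [h] using hij.le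
      · simp [hb]
    · simpa [h] using hij
  · exact zero_mem _

lemma lieDer_skew_mem_weightLT {i j : Fin n} (hij : i < j) {r : ℕ} {f : PlRing n k}
    (hf : f ∈ weightLT n k (r + 1)) : lieDer k (skew i j) f ∈ weightLT n k r :=
  derivation_mem_weightLT _ (fun K => by
    rw [lieDer_skew]
    exact sub_mem (lieDer_elem_X_mem_weightLT hij K)
      (lieDer_elem_X_mem_weightLT (Fin.rev_lt_rev.2 hij) K)) hf

lemma skew_commutator {i j : Fin n} (hij : i ≠ j) :
    skew i j ∘ₗ skew j i - skew j i ∘ₗ skew i j =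
      if j = i.rev then 0 else skew i i - skew j j := by
  have he : ∀ p q r s : Fin n, elem p q ∘ₗ elem r s = if r = q then elem p s else 0 :=
    fun p q r s => by
      refine LinearMap.ext fun v => ?_
      rw [LinearMap.comp_apply, elem_apply r s, map_smul, elem_stdVec]
      split_ifs
      · rfl
      · simp
  split_ifs with h
  · subst h
    simp [skew]
  · have h' : ¬ i.rev = j := fun h' => h h'.symm
    have h'' : ¬ i = j.rev := fun h' => h (by rw [h', Fin.rev_rev])
    have hji : ¬ j.rev = i := fun h' => h'' h'.symm
    simp only [skew, LinearMap.comp_sub, LinearMap.sub_comp, he, h, h', h'', hji,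
      if_true, if_false]
    abel

lemma lieDer_skew_skew_of_ne {i j : Fin n} (hij : i ≠ j) (f : PlRing n k) :
    lieDer k (skew i j) (lieDer k (skew j i) f) =
      lieDer k (skew j i) (lieDer k (skew i j) f) +
        if j = i.rev then 0 else lieDer k (skew i i) f - lieDer k (skew j j) f := by
  rw [← sub_eq_iff_eq_add', lieDer_commutator, skew_commutator hij]
  split_ifs
  · have := lieDer_sub (k := k) (0 : (Fin n → ℂ) →ₗ[ℂ] (Fin n → ℂ)) 0
    rw [sub_self, sub_self] at this
    rw [this, Derivation.zero_apply]
  · rw [lieDer_sub, Derivation.sub_apply]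

end Weights

section Diagonal

variable {n k : ℕ}

lemma derivation_monomial_of_diagonal {σ : Type*} [Fintype σ]
    (D : Derivation ℂ (MvPolynomial σ ℂ) (MvPolynomial σ ℂ)) (c : σ → ℤ)
    (hD : ∀ K, D (MvPolynomial.X K) = c K • MvPolynomial.X K) (s : σ →₀ ℕ) (a : ℂ) :
    D (MvPolynomial.monomial s a) = (∑ K, (s K : ℤ) * c K) • MvPolynomial.monomial s a := by
  induction s using Finsupp.induction_linear generalizing a with
  | zero =>
    change D (MvPolynomial.C a) = _
    simp [MvPolynomial.derivation_C]
  | add s t hs ht =>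
    have : (MvPolynomial.monomial (s + t) a : MvPolynomial σ ℂ) =
        MvPolynomial.monomial s a * MvPolynomial.monomial t 1 := by
      rw [MvPolynomial.monomial_mul, mul_one]
    rw [this, Derivation.leibniz, hs, ht]
    simp only [smul_eq_mul, zsmul_eq_mul, Finsupp.add_apply, Nat.cast_add, add_mul,
      Finset.sum_add_distrib, Int.cast_add]
    ring
  | single K e =>
    have : (MvPolynomial.monomial (Finsupp.single K e) a : MvPolynomial σ ℂ) =
        a • MvPolynomial.X K ^ e := by
      rw [MvPolynomial.X_pow_eq_monomial, MvPolynomial.smul_monomial, smul_eq_mul, mul_one]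
    have hsum : ∑ L, ((Finsupp.single K e L : ℕ) : ℤ) * c L = e * c K := by
      rw [Finset.sum_eq_single K (fun L _ hL => by simp [Finsupp.single_eq_of_ne hL]) (by simp)]
      simp
    rw [hsum, this, Derivation.map_smul, Derivation.leibniz_pow, hD, smul_comm _ a]
    refine congrArg (a • ·) ?_
    rcases e with - | e
    · simp
    · simp only [Nat.add_sub_cancel, smul_eq_mul, zsmul_eq_mul, nsmul_eq_mul]
      push_cast
      ring

/-- The number of occurrences of the index `i` in a monomial in the Plücker variables. -/
def occ (s : {K : Finset (Fin n) // K.card = k} →₀ ℕ) (i : Fin n) : ℤ :=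
  ∑ K, (s K : ℤ) * if i ∈ K.1 then 1 else 0

/-- The degree of a monomial in the Plücker variables. -/
def monDeg (s : {K : Finset (Fin n) // K.card = k} →₀ ℕ) : ℤ := ∑ K, (s K : ℤ) * 1

lemma lieDer_elem_self_X (i : Fin n) (K : {K : Finset (Fin n) // K.card = k}) :
    lieDer k (elem i i) (MvPolynomial.X K) = (if i ∈ K.1 then (1 : ℤ) else 0) •
      MvPolynomial.X K := by
  rw [← plucker_enum, lieDer_elem_stdFam]
  split_ifs with hi
  · rw [← Finset.image_orderEmbOfFin_univ K.1 K.2] at hi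
    obtain ⟨a, -, ha⟩ := Finset.mem_image.1 hi
    rw [Finset.sum_eq_single a]
    · rw [if_pos ha, one_smul]
      congr 2
      rw [← ha]
      exact Function.update_eq_self _ _
    · intro b _ hb
      exact if_neg fun h => hb (enum_injective K (h.trans ha.symm))
    · simp
  · rw [zero_smul]
    exact Finset.sum_eq_zero fun a _ => if_neg fun h : enum K a = i =>
      hi (h ▸ Finset.orderEmbOfFin_mem K.1 K.2 a)

lemma lieDer_skew_self_monomial (i : Fin n) (s : {K : Finset (Fin n) // K.card = k} →₀ ℕ)
    (c : ℂ) : lieDer k (skew i i) (MvPolynomial.monomial s c) =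
      (occ s i - occ s i.rev) • MvPolynomial.monomial s c := by
  rw [lieDer_skew, derivation_monomial_of_diagonal _ _ (lieDer_elem_self_X i),
    derivation_monomial_of_diagonal _ _ (lieDer_elem_self_X i.rev), ← sub_smul]
  rfl

lemma euler_monomial (s : {K : Finset (Fin n) // K.card = k} →₀ ℕ) (c : ℂ) :
    euler n k (MvPolynomial.monomial s c) = monDeg s • MvPolynomial.monomial s c :=
  derivation_monomial_of_diagonal _ (fun _ => 1) (fun K => by rw [euler_X, one_smul]) s c

/-- The diagonal part of the Casimir operator, minus its scalar value in terms of the Euler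
derivation. -/
noncomputable def diagOp (n k : ℕ) : PlRing n (k + 1) →ₗ[ℂ] PlRing n (k + 1) :=
  ∑ i, ∑ j, (if i = j then (lieDer (k + 1) (skew i i)).toLinearMap ∘ₗ
        (lieDer (k + 1) (skew i i)).toLinearMap
      else if i < j ∧ j ≠ i.rev then
        (lieDer (k + 1) (skew i i)).toLinearMap - (lieDer (k + 1) (skew j j)).toLinearMap
      else 0) -
    ((2 * (k + 1) : ℤ) • (euler n (k + 1)).toLinearMap ∘ₗ (euler n (k + 1)).toLinearMap +
      (2 * (k + 1) * (n - k - 2) : ℤ) • (euler n (k + 1)).toLinearMap)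

lemma diagOp_apply (f : PlRing n (k + 1)) : diagOp n k f =
    ∑ i, ∑ j, (if i = j then lieDer (k + 1) (skew i i) (lieDer (k + 1) (skew i i) f)
      else if i < j ∧ j ≠ i.rev then
        lieDer (k + 1) (skew i i) f - lieDer (k + 1) (skew j j) f
      else 0) -
    (2 * (k + 1) * euler n (k + 1) (euler n (k + 1) f) +
      2 * (k + 1) * (n - k - 2) * euler n (k + 1) f) := by
  rw [diagOp, LinearMap.sub_apply, LinearMap.sum_apply]
  congr 1
  · refine Finset.sum_congr rfl fun i _ => ?_
    rw [LinearMap.sum_apply]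
    refine Finset.sum_congr rfl fun j _ => ?_
    split_ifs <;> rfl
  · rw [LinearMap.add_apply, LinearMap.smul_apply, LinearMap.smul_apply, zsmul_eq_mul,
      zsmul_eq_mul]
    push_cast
    rfl

lemma diagOp_mem {f : PlRing n (k + 1)} (hf : f ∈ relIdeal n k Fin.rev) :
    diagOp n k f ∈ relIdeal n k Fin.rev := by
  rw [diagOp_apply]
  refine sub_mem (sum_mem fun i _ => sum_mem fun j _ => ?_) (add_mem
    (Ideal.mul_mem_left _ _ (euler_mem _ (euler_mem _ hf)))
    (Ideal.mul_mem_left _ _ (euler_mem _ hf)))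
  split_ifs
  · exact lieDer_skew_mem _ _ (lieDer_skew_mem _ _ hf)
  · exact sub_mem (lieDer_skew_mem _ _ hf) (lieDer_skew_mem _ _ hf)
  · exact zero_mem _

lemma diagOp_mem_of_forall_lt {f : PlRing n (k + 1)}
    (hf : ∀ i j : Fin n, i < j → lieDer (k + 1) (skew i j) f ∈ relIdeal n k Fin.rev) :
    diagOp n k f ∈ relIdeal n k Fin.rev := by
  have h := casimir_sub_euler_mem f
  rw [diagOp_apply, ← sub_add_sub_cancel _ (∑ i, ∑ j, lieDer (k + 1) (skew i j)
    (lieDer (k + 1) (skew j i) f))]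
  refine add_mem ?_ h
  simp only [← Finset.sum_sub_distrib]
  refine sum_mem fun i _ => sum_mem fun j _ => ?_
  rcases lt_trichotomy i j with hij | rfl | hij
  · rw [if_neg hij.ne, lieDer_skew_skew_of_ne hij.ne]
    have := lieDer_skew_mem j i (hf i j hij)
    by_cases hj : j = i.rev
    · rw [if_neg fun h => h.2 hj, if_pos hj, add_zero, zero_sub]
      exact neg_mem this
    · rw [if_pos ⟨hij, hj⟩, if_neg hj, sub_add_cancel_right]
      exact neg_mem this
  · rw [if_pos rfl, sub_self]
    exact zero_mem _
  · rw [if_neg hij.ne', if_neg fun h => hij.not_gt h.1, zero_sub]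
    exact neg_mem (lieDer_skew_mem i j (hf j i hij))

/-- The eigenvalue of `diagOp` on a monomial. -/
def diagEigenvalue (s : {K : Finset (Fin n) // K.card = k + 1} →₀ ℕ) : ℤ :=
  ∑ i, ∑ j, (if i = j then (occ s i - occ s i.rev) ^ 2
      else if i < j ∧ j ≠ i.rev then
        (occ s i - occ s i.rev) - (occ s j - occ s j.rev)
      else 0) -
    (2 * (k + 1) * monDeg s ^ 2 + 2 * (k + 1) * (n - k - 2) * monDeg s)

lemma diagOp_monomial (s : {K : Finset (Fin n) // K.card = k + 1} →₀ ℕ) (c : ℂ) :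
    diagOp n k (MvPolynomial.monomial s c) =
      (diagEigenvalue s : ℂ) • MvPolynomial.monomial s c := by
  rw [diagOp_apply, Int.cast_smul_eq_zsmul, diagEigenvalue, sub_smul, Finset.sum_smul]
  congr 1
  · refine Finset.sum_congr rfl fun i _ => ?_
    rw [Finset.sum_smul]
    refine Finset.sum_congr rfl fun j _ => ?_
    split_ifs
    · rw [lieDer_skew_self_monomial, map_zsmul, lieDer_skew_self_monomial, smul_smul, sq]
    · rw [lieDer_skew_self_monomial, lieDer_skew_self_monomial, ← sub_smul]
    · rw [zero_smul]
  · rw [euler_monomial, map_zsmul, euler_monomial, smul_smul, add_smul]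
    simp only [zsmul_eq_mul]
    push_cast
    ring

end Diagonal

section Extremal

variable {n k : ℕ}

/-- The coefficient of the `i`-th coordinate in the sum of the positive roots. -/
def rootCoeff (i : Fin n) : ℤ :=
  if i < i.rev then n - 2 - 2 * i else if i.rev < i then n - 2 * i else 0

lemma sum_ite_lt_and_ne_rev (i : Fin n) :
    ∑ j : Fin n, (if i < j ∧ j ≠ i.rev then (1 : ℤ) else 0) -
      ∑ j : Fin n, (if j < i ∧ j ≠ i.rev then (1 : ℤ) else 0) = rootCoeff i := by
  have h1 : ∀ j, (if i < j ∧ j ≠ i.rev then (1 : ℤ) else 0) =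
      (if i < j then 1 else 0) - if j = i.rev then (if i < i.rev then 1 else 0) else 0 := by
    intro j
    by_cases hj : j = i.rev
    · subst hj
      simp
    · simp [hj]
  have h2 : ∀ j, (if j < i ∧ j ≠ i.rev then (1 : ℤ) else 0) =
      (if j < i then 1 else 0) - if j = i.rev then (if i.rev < i then 1 else 0) else 0 := by
    intro j
    by_cases hj : j = i.rev
    · subst hj
      simp
    · simp [hj]
  have c1 : (Finset.univ.filter fun j => i < j).card = n - 1 - i := by
    rw [← Fin.card_Ioi i]
    congr 1
    ext
    simp
  have c2 : (Finset.univ.filter fun j => j < i).card = i := by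
    rw [← Fin.card_Iio i]
    congr 1
    ext
    simp
  simp only [h1, h2, Finset.sum_sub_distrib, Finset.sum_ite_eq', Finset.mem_univ, if_true,
    Finset.sum_boole, c1, c2, rootCoeff]
  have := i.2
  split_ifs with h h' h'
  · exact absurd h h'.not_gt
  · push_cast [show (i : ℕ) ≤ n - 1 by omega, show 1 ≤ n by omega]
    omega
  · omega
  · have : i = i.rev := le_antisymm (not_lt.1 h') (not_lt.1 h)
    rw [Fin.ext_iff, Fin.val_rev] at this
    omega

lemma sum_sum_roots (y : Fin n → ℤ) :
    ∑ i, ∑ j, (if i = j then y i ^ 2 else if i < j ∧ j ≠ i.rev then y i - y j else 0) =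
      ∑ i, (y i ^ 2 + rootCoeff i * y i) := by
  have h : ∀ i j, (if i = j then y i ^ 2 else if i < j ∧ j ≠ i.rev then y i - y j else 0) =
      (if i = j then y i ^ 2 else 0) + ((if i < j ∧ j ≠ i.rev then (1 : ℤ) else 0) * y i -
        (if i < j ∧ j ≠ i.rev then (1 : ℤ) else 0) * y j) := by
    intro i j
    by_cases hij : i = j
    · subst hij
      simp
    · simp only [hij, if_false, zero_add]
      split_ifs <;> ring
  simp only [h, Finset.sum_add_distrib, Finset.sum_sub_distrib]
  rw [Finset.sum_comm (f := fun i j => (if i < j ∧ j ≠ i.rev then (1 : ℤ) else 0) * y j),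
    ← Finset.sum_sub_distrib]
  congr 1
  · simp
  · refine Finset.sum_congr rfl fun i _ => ?_
    rw [← sum_ite_lt_and_ne_rev, sub_mul, Finset.sum_mul, Finset.sum_mul]
    simp only [ne_eq, ← Fin.rev_eq_iff (i := i), eq_comm (a := i.rev)]

lemma quadratic_le_of_lt {a a' d b c : ℤ} (ha : 0 ≤ a) (ha' : 0 ≤ a') (had : a ≤ d)
    (had' : a' ≤ d) (hc : 1 ≤ c) (hbc : c ≤ b) :
    (a - a') ^ 2 + b * (a - a') - (d + b - c) * (a + a') - c * d ≤ 0 ∧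
      ((a - a') ^ 2 + b * (a - a') - (d + b - c) * (a + a') - c * d = 0 → a = d) := by
  rcases le_or_gt a' a with h | h
  · have e : (a - a') ^ 2 + b * (a - a') - (d + b - c) * (a + a') - c * d =
        -((d - (a - a')) * (a - a' + c) + 2 * ((d + b - c) * a')) := by ring
    have h1 : 0 ≤ (d + b - c) * a' := mul_nonneg (by linarith) ha'
    have h2 : 0 ≤ (d - (a - a')) * (a - a' + c) := mul_nonneg (by linarith) (by linarith)
    rw [e]
    refine ⟨by linarith, fun h0 => ?_⟩
    have h3 : (d - (a - a')) * (a - a' + c) = 0 := by linarith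
    rcases mul_eq_zero.1 h3 with h3 | h3 <;> linarith
  · have e : (a - a') ^ 2 + b * (a - a') - (d + b - c) * (a + a') - c * d =
        -((d - (a' - a)) * (a' - a + c) + 2 * (b * (a' - a)) + 2 * ((d + b - c) * a)) := by ring
    have h1 : 0 ≤ (d + b - c) * a := mul_nonneg (by linarith) ha
    have h2 : 0 ≤ (d - (a' - a)) * (a' - a + c) := mul_nonneg (by linarith) (by linarith)
    have h3 : 0 < b * (a' - a) := mul_pos (by linarith) (by linarith)
    rw [e]
    exact ⟨by linarith, fun h0 => by linarith⟩

lemma quadratic_le_of_abs_le {a a' d b c : ℤ} (ha : 0 ≤ a) (ha' : 0 ≤ a') (had : a ≤ d)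
    (had' : a' ≤ d) (hb : |b| ≤ c) :
    (a - a') ^ 2 + b * (a - a') - (d + c) * (a + a') ≤ 0 := by
  obtain ⟨hb1, hb2⟩ := abs_le.1 hb
  rcases le_or_gt a' a with h | h
  · nlinarith [mul_nonneg (sub_nonneg.2 h) (sub_nonneg.2 hb2),
      mul_nonneg (sub_nonneg.2 h) (show 0 ≤ d - (a - a') by linarith),
      mul_nonneg ha' (show 0 ≤ d + c by linarith)]
  · nlinarith [mul_nonneg (sub_nonneg.2 h.le) (show 0 ≤ b + c by linarith),
      mul_nonneg (sub_nonneg.2 h.le) (show 0 ≤ d - (a' - a) by linarith),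
      mul_nonneg ha (show 0 ≤ d + c by linarith)]

lemma sum_odd_lt (hkn : k + 1 ≤ n) :
    ∑ i : Fin n, (if (i : ℕ) < k + 1 then (2 * (k - i) + 1 : ℤ) else 0) = (k + 1) ^ 2 := by
  rw [Fin.sum_univ_eq_sum_range (fun i => if i < k + 1 then (2 * (k - i) + 1 : ℤ) else 0) n,
    ← Finset.sum_subset (Finset.range_mono hkn) fun i _ hi => if_neg (by simpa using hi)]
  have : ∀ m : ℕ, ∑ i ∈ Finset.range m, (2 * (k - i) + 1 : ℤ) = m * (2 * k + 2) - m ^ 2 := by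
    intro m
    induction m with
    | zero => simp
    | succ m ih =>
      rw [Finset.sum_range_succ, ih]
      push_cast
      ring
  rw [Finset.sum_congr rfl fun i hi => if_pos (Finset.mem_range.1 hi), this]
  push_cast
  ring

lemma eq_of_sum_roots_eq (hn : 2 * (k + 1) < n) {d : ℤ} {m : Fin n → ℤ} (h0 : ∀ i, 0 ≤ m i)
    (hd : ∀ i, m i ≤ d) (hsum : ∑ i, m i = (k + 1) * d)
    (h : ∑ i, ((m i - m i.rev) ^ 2 + rootCoeff i * (m i - m i.rev)) =
      2 * (k + 1) * d ^ 2 + 2 * (k + 1) * (n - k - 2) * d)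
    (i : Fin n) (hi : (i : ℕ) < k + 1) : m i = d := by
  set t : ℤ := n - 2 * k - 3 with ht
  let c : Fin n → ℤ := fun i => if (i : ℕ) < k + 1 then 2 * (k - i) + 1 else 0
  let φ : Fin n → ℤ := fun i => (m i - m i.rev) ^ 2 + rootCoeff i * (m i - m i.rev) -
    (d + t) * (m i + m i.rev) - (c i * d + c i.rev * d)
  have hφ : ∀ i, φ i ≤ 0 ∧ ((i : ℕ) < k + 1 → φ i = 0 → m i = d) := by
    intro i
    have hi := i.2
    have hr := Fin.val_rev i
    have hcond : ∀ j : Fin n, (j : ℕ) < k + 1 → rootCoeff j = n - 2 - 2 * j ∧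
        rootCoeff j.rev = -(n - 2 - 2 * j) ∧ c j = 2 * (k - j) + 1 ∧ c j.rev = 0 := by
      intro j hj
      have hjr := Fin.val_rev j
      have h1 : j < j.rev := by
        rw [Fin.lt_def]
        omega
      refine ⟨?_, ?_, if_pos hj, if_neg (by omega)⟩
      · rw [rootCoeff, if_pos h1]
      · rw [rootCoeff, Fin.rev_rev, if_neg h1.not_gt, if_pos h1, hjr]
        omega
    by_cases h1 : (i : ℕ) < k + 1
    · obtain ⟨e1, -, e2, e3⟩ := hcond i h1
      have key := quadratic_le_of_lt (b := n - 2 - 2 * i) (c := 2 * (k - i) + 1) (h0 i)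
        (h0 i.rev) (hd i) (hd i.rev) (by omega) (by omega)
      have e : φ i = (m i - m i.rev) ^ 2 + (n - 2 - 2 * i) * (m i - m i.rev) -
          (d + (n - 2 - 2 * i) - (2 * (k - i) + 1)) * (m i + m i.rev) -
            (2 * (k - i) + 1) * d := by
        simp only [φ, e1, e2, e3, ht]
        ring
      rw [e]
      exact ⟨key.1, fun _ => key.2⟩
    · refine ⟨?_, fun h => absurd h h1⟩
      by_cases h2 : (i.rev : ℕ) < k + 1
      · obtain ⟨-, e1, e2, e3⟩ := hcond i.rev h2
        rw [Fin.rev_rev] at e1 e3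
        have key := quadratic_le_of_lt (b := n - 2 - 2 * i.rev) (c := 2 * (k - i.rev) + 1)
          (h0 i.rev) (h0 i) (hd i.rev) (hd i) (by omega) (by omega)
        have e : φ i = (m i.rev - m i) ^ 2 + (n - 2 - 2 * i.rev) * (m i.rev - m i) -
            (d + (n - 2 - 2 * i.rev) - (2 * (k - i.rev) + 1)) * (m i.rev + m i) -
              (2 * (k - i.rev) + 1) * d := by
          simp only [φ, e1, e2, e3, ht]
          ring
        rw [e]
        exact key.1
      · have e2 : c i = 0 := if_neg h1
        have e3 : c i.rev = 0 := if_neg h2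
        have key := quadratic_le_of_abs_le (b := rootCoeff i) (c := t) (h0 i) (h0 i.rev) (hd i)
          (hd i.rev) (by
            rw [abs_le, rootCoeff]
            split_ifs <;> simp only [Fin.lt_def] at * <;> omega)
        simp only [φ, e2, e3]
        linarith
  have hrev : ∀ f : Fin n → ℤ, ∑ i : Fin n, f i.rev = ∑ i, f i := fun f =>
    Equiv.sum_comp Fin.revPerm f
  have hc : ∑ i, c i = (k + 1) ^ 2 := sum_odd_lt (by omega)
  have hφsum : ∑ i, φ i = 0 := by
    have e : ∑ i, φ i = ∑ i, ((m i - m i.rev) ^ 2 + rootCoeff i * (m i - m i.rev)) -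
        (d + t) * (∑ i, m i + ∑ i : Fin n, m i.rev) -
          ((∑ i, c i) * d + (∑ i : Fin n, c i.rev) * d) := by
      simp only [φ, Finset.sum_sub_distrib, Finset.sum_add_distrib, Finset.mul_sum,
        Finset.sum_mul, mul_add]
    rw [e, h, hrev m, hrev c, hsum, hc, ht]
    ring
  exact (hφ i).2 hi ((Finset.sum_eq_zero_iff_of_nonpos fun i _ => (hφ i).1).1 hφsum i
    (Finset.mem_univ i))

end Extremal

section Primality

variable {n k : ℕ}

lemma diagEigenvalue_eq (s : {K : Finset (Fin n) // K.card = k + 1} →₀ ℕ) :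
    diagEigenvalue s = ∑ i, ((occ s i - occ s i.rev) ^ 2 +
        rootCoeff i * (occ s i - occ s i.rev)) -
      (2 * (k + 1) * monDeg s ^ 2 + 2 * (k + 1) * (n - k - 2) * monDeg s) := by
  rw [diagEigenvalue, sum_sum_roots fun i => occ s i - occ s i.rev]

lemma occ_nonneg (s : {K : Finset (Fin n) // K.card = k} →₀ ℕ) (i : Fin n) : 0 ≤ occ s i :=
  Finset.sum_nonneg fun K _ => mul_nonneg (by positivity) (by split_ifs <;> norm_num)

lemma occ_le_monDeg (s : {K : Finset (Fin n) // K.card = k} →₀ ℕ) (i : Fin n) :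
    occ s i ≤ monDeg s :=
  Finset.sum_le_sum fun K _ => mul_le_mul_of_nonneg_left (by split_ifs <;> norm_num)
    (by positivity)

lemma sum_occ (s : {K : Finset (Fin n) // K.card = k} →₀ ℕ) : ∑ i, occ s i = k * monDeg s := by
  simp only [occ, monDeg]
  rw [Finset.sum_comm, Finset.mul_sum]
  refine Finset.sum_congr rfl fun K _ => ?_
  rw [← Finset.mul_sum, Finset.sum_boole, Finset.filter_univ_mem, K.2]
  ring

lemma mem_of_occ_eq_monDeg {s : {K : Finset (Fin n) // K.card = k} →₀ ℕ} {i : Fin n}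
    (h : occ s i = monDeg s) {K : {K : Finset (Fin n) // K.card = k}} (hK : s K ≠ 0) :
    i ∈ K.1 := by
  by_contra hi
  refine h.not_lt (Finset.sum_lt_sum (fun L _ => mul_le_mul_of_nonneg_left
    (by split_ifs <;> norm_num) (by positivity)) ⟨K, Finset.mem_univ _, ?_⟩)
  rw [if_neg hi]
  have := Nat.pos_of_ne_zero hK
  simpa

/-- The set of the first `k` indices. -/
def firstSet (h : k ≤ n) : {K : Finset (Fin n) // K.card = k} :=
  ⟨Finset.univ.map (Fin.castLEEmb h), by simp⟩

lemma mem_firstSet (h : k ≤ n) (i : Fin n) : i ∈ (firstSet h).1 ↔ (i : ℕ) < k := by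
  simp only [firstSet, Finset.mem_map, Finset.mem_univ, true_and]
  exact ⟨fun ⟨a, ha⟩ => ha ▸ a.2, fun hi => ⟨⟨i, hi⟩, rfl⟩⟩

lemma eq_single_of_diagEigenvalue_eq_zero (hn : 2 * (k + 1) < n)
    {s : {K : Finset (Fin n) // K.card = k + 1} →₀ ℕ} (hs : diagEigenvalue s = 0) :
    s = Finsupp.single (firstSet (by omega)) (s (firstSet (by omega))) := by
  have h := eq_of_sum_roots_eq hn (occ_nonneg s) (occ_le_monDeg s)
    (by rw [sum_occ]; push_cast; ring) (by rw [diagEigenvalue_eq] at hs; linarith)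
  rw [Finsupp.eq_single_iff]
  refine ⟨fun K hK => ?_, rfl⟩
  rw [Finset.mem_singleton, Subtype.ext_iff, eq_comm]
  refine Finset.eq_of_subset_of_card_le (fun i hi => ?_) (by rw [K.2, (firstSet _).2])
  exact mem_of_occ_eq_monDeg (h i ((mem_firstSet _ i).1 hi)) (Finsupp.mem_support_iff.1 hK)

/-- Restriction of polynomials to the coordinate line through the coordinate plane spanned by the
first basis vectors. -/
noncomputable def restrictFirst (h : k ≤ n) : PlRing n k →ₐ[ℂ] PlRing n k :=
  MvPolynomial.aeval fun K => if K = firstSet h then MvPolynomial.X K else 0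

lemma restrictFirst_Xv (h : k ≤ n) {K : Finset (Fin n)} (hK : K ≠ (firstSet h).1) :
    restrictFirst h (Xv n k K) = 0 := by
  by_cases hc : K.card = k
  · rw [Xv, dif_pos hc, restrictFirst, MvPolynomial.aeval_X, if_neg fun h' => hK (by rw [← h'])]
  · rw [Xv, dif_neg hc, map_zero]

lemma restrictFirst_monomial_single (h : k ≤ n) (d : ℕ) (c : ℂ) :
    restrictFirst h (MvPolynomial.monomial (Finsupp.single (firstSet h) d) c) =
      MvPolynomial.monomial (Finsupp.single (firstSet h) d) c := by
  have : (MvPolynomial.monomial (Finsupp.single (firstSet h) d) c : PlRing n k) =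
      c • MvPolynomial.X (firstSet h) ^ d := by
    rw [MvPolynomial.X_pow_eq_monomial, MvPolynomial.smul_monomial, smul_eq_mul, mul_one]
  rw [this, map_smul, map_pow, restrictFirst, MvPolynomial.aeval_X, if_pos rfl]

lemma relIdeal_le_ker_restrictFirst (hn : 2 * (k + 1) < n) :
    relIdeal n k Fin.rev ≤ RingHom.ker (restrictFirst (n := n) (k := k + 1) (by omega)) := by
  refine relIdeal_le_of_enum _ _ (fun I J => ?_) fun I J => ?_
  · rw [pluckerRel_enum, RingHom.mem_ker, map_mul, GP, map_sum, Finset.sum_eq_zero, mul_zero]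
    intro j hj
    rw [map_mul, map_mul]
    by_cases h : J.1.erase j = (firstSet (n := n) (k := k + 1) (by omega)).1
    · rw [restrictFirst_Xv (K := insert j I.1), mul_zero, zero_mul]
      intro h'
      exact Finset.notMem_erase j J.1 (h ▸ h' ▸ Finset.mem_insert_self j I.1)
    · rw [restrictFirst_Xv _ h, mul_zero]
  · rw [RingHom.mem_ker, orthRel, map_sum]
    refine Finset.sum_eq_zero fun l _ => ?_
    have hl : ∀ (I : {K : Finset (Fin n) // K.card = k}) (l : Fin n), k + 1 ≤ (l : ℕ) →
        restrictFirst (n := n) (k := k + 1) (by omega)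
          (plucker n (k + 1) (vecCons (stdVec l) (stdFam (enum I)))) = 0 := fun I l hl => by
      rw [plucker_cons_enum]
      split_ifs
      · exact map_zero _
      · rw [map_mul, restrictFirst_Xv, mul_zero]
        intro h
        exact hl.not_gt ((mem_firstSet _ l).1 (h ▸ Finset.mem_insert_self l I.1))
    rw [map_mul]
    by_cases h : k + 1 ≤ (l : ℕ)
    · rw [hl I l h, zero_mul]
    · rw [hl J l.rev (by rw [Fin.val_rev]; omega), mul_zero]

lemma aeval_apply_of_eigen {V : Type*} [AddCommGroup V] [Module ℂ V] (Q : Module.End ℂ V)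
    {q : ℂ} {v : V} (h : Q v = q • v) (p : Polynomial ℂ) :
    Polynomial.aeval Q p v = p.eval q • v := by
  induction p using Polynomial.induction_on with
  | C a => simp
  | add p r hp hr => simp [hp, hr, add_smul]
  | monomial m a ih =>
    rw [pow_succ, ← mul_assoc, map_mul, Polynomial.aeval_X, Module.End.mul_apply, h, map_smul, ih,
      smul_smul, Polynomial.eval_mul_X, mul_comm]

/-- If `Q` maps a sum of eigenvectors into a `Q`-stable subspace, the difference between this sum
and its component of eigenvalue zero lies in this subspace. -/
lemma sum_sub_sum_filter_mem {V ι : Type*} [AddCommGroup V] [Module ℂ V] (Q : Module.End ℂ V)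
    (W : Submodule ℂ V) (hW : ∀ v ∈ W, Q v ∈ W) (S : Finset ι) (v : ι → V) (q : ι → ℂ)
    (h : ∀ s, Q (v s) = q s • v s) (hQ : Q (∑ s ∈ S, v s) ∈ W) :
    ∑ s ∈ S, v s - ∑ s ∈ S.filter (fun s => q s = 0), v s ∈ W := by
  classical
  let p : Polynomial ℂ := ∏ s ∈ S.filter (fun s => q s ≠ 0), (Polynomial.X - Polynomial.C (q s))
  have hp0 : p.eval 0 ≠ 0 := by
    rw [Polynomial.eval_prod, Finset.prod_ne_zero_iff]
    intro s hs
    simpa using (Finset.mem_filter.1 hs).2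
  have h1 : Polynomial.aeval Q p (∑ s ∈ S, v s) =
      p.eval 0 • ∑ s ∈ S.filter (fun s => q s = 0), v s := by
    rw [map_sum, Finset.sum_filter, Finset.smul_sum]
    refine Finset.sum_congr rfl fun s hs => ?_
    rw [aeval_apply_of_eigen Q (h s)]
    split_ifs with hq
    · rw [hq]
    · rw [smul_zero]
      have : p.eval (q s) = 0 := by
        rw [Polynomial.eval_prod]
        exact Finset.prod_eq_zero (Finset.mem_filter.2 ⟨hs, hq⟩) (by simp)
      rw [this, zero_smul]
  have hstab : ∀ (r : Polynomial ℂ) (w : V), w ∈ W → Polynomial.aeval Q r w ∈ W := by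
    intro r w hw
    induction r using Polynomial.induction_on generalizing w with
    | C a => simpa using W.smul_mem a hw
    | add p r hp hr => simpa using add_mem (hp w hw) (hr w hw)
    | monomial m a ih =>
      rw [pow_succ, ← mul_assoc, map_mul, Polynomial.aeval_X]
      exact ih _ (hW _ hw)
  have h2 : p = p.divX * Polynomial.X + Polynomial.C (p.eval 0) := by
    rw [← Polynomial.coeff_zero_eq_eval_zero, Polynomial.divX_mul_X_add]
  have h3 : Polynomial.aeval Q p (∑ s ∈ S, v s) - p.eval 0 • ∑ s ∈ S, v s ∈ W := by
    have := hstab p.divX _ hQ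
    have e : Polynomial.aeval Q p (∑ s ∈ S, v s) =
        Polynomial.aeval Q p.divX (Q (∑ s ∈ S, v s)) + p.eval 0 • ∑ s ∈ S, v s := by
      conv_lhs => rw [h2]
      rw [map_add, map_mul, Polynomial.aeval_X, Polynomial.aeval_C]
      rfl
    rwa [e, add_sub_cancel_right]
  rw [h1, ← smul_sub, Submodule.smul_mem_iff _ hp0] at h3
  simpa using neg_mem h3

lemma mem_of_diagOp_mem (hn : 2 * (k + 1) < n) {P : Ideal (PlRing n (k + 1))}
    (hI : relIdeal n k Fin.rev ≤ P)
    (hP : P ≤ RingHom.ker (restrictFirst (n := n) (k := k + 1) (by omega)))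
    {f : PlRing n (k + 1)} (hf : f ∈ P) (hQ : diagOp n k f ∈ relIdeal n k Fin.rev) :
    f ∈ relIdeal n k Fin.rev := by
  have h := sum_sub_sum_filter_mem (diagOp n k) ((relIdeal n k Fin.rev).restrictScalars ℂ)
    (fun v hv => diagOp_mem hv) f.support
    (fun s => (MvPolynomial.monomial s (f.coeff s) : PlRing n (k + 1)))
    (fun s => (diagEigenvalue s : ℂ)) (fun s => diagOp_monomial s _)
    (by rw [← MvPolynomial.as_sum]; exact hQ)
  rw [← MvPolynomial.as_sum, Submodule.restrictScalars_mem] at h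
  set f₀ := ∑ s ∈ f.support.filter (fun s => (diagEigenvalue s : ℂ) = 0),
    (MvPolynomial.monomial s (f.coeff s) : PlRing n (k + 1)) with hf₀
  have h0 : restrictFirst (by omega) f₀ = 0 := by
    have := hP (sub_mem hf (hI h))
    rwa [sub_sub_cancel] at this
  have h1 : restrictFirst (n := n) (k := k + 1) (by omega) f₀ = f₀ := by
    rw [hf₀, map_sum]
    refine Finset.sum_congr rfl fun s hs => ?_
    rw [eq_single_of_diagEigenvalue_eq_zero hn (Int.cast_eq_zero.1 (Finset.mem_filter.1 hs).2)]
    exact restrictFirst_monomial_single _ _ _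
  rwa [← h1, h0, sub_zero] at h

lemma relIdeal_rev_isPrime (hn : 2 * (k + 1) < n) : (relIdeal n k Fin.rev).IsPrime := by
  have := RingHom.ker_isPrime (restrictFirst (n := n) (k := k + 1) (by omega))
  obtain ⟨P, hP, hPM⟩ := Ideal.exists_minimalPrimes_le (relIdeal_le_ker_restrictFirst hn)
  have hIP : relIdeal n k Fin.rev ≤ P := hP.1.2
  suffices h : ∀ (r : ℕ) (f : PlRing n (k + 1)), f ∈ P → f ∈ weightLT n (k + 1) r →
      f ∈ relIdeal n k Fin.rev by
    have : relIdeal n k Fin.rev = P := le_antisymm hIP fun f hf =>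
      (exists_mem_weightLT f).elim fun r hr => h r f hf hr
    rw [this]
    exact hP.1.1
  intro r
  induction r with
  | zero =>
    intro f _ hf
    have : f = 0 := MvPolynomial.support_eq_empty.1
      (Finset.eq_empty_of_forall_notMem fun s hs => Nat.not_lt_zero _ (hf hs))
    rw [this]
    exact zero_mem _
  | succ r ih =>
    intro f hfP hf
    exact mem_of_diagOp_mem hn hIP hPM hfP (diagOp_mem_of_forall_lt fun i j hij =>
      ih _ (derivation_mem_of_mem_minimalPrimes hP _ (fun g hg => lieDer_skew_mem i j hg) hfP)
        (lieDer_skew_mem_weightLT hij hf))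

end Primality

end OrthogonalGrassmannian

/-- For `k ≥ 1` and `n > 2k`, the ideal `I_{k,n}` is prime. -/
theorem statement9 {k n : ℕ} (hk : 1 ≤ k) (hn : 2 * k < n) :
    (Ikn n k).IsPrime := by
  obtain ⟨k, rfl⟩ := Nat.exists_eq_add_of_le' hk
  rw [OrthogonalGrassmannian.Ikn_eq_relIdeal]
  exact OrthogonalGrassmannian.relIdeal_id_isPrime
    (OrthogonalGrassmannian.relIdeal_rev_isPrime hn)
end
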